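/- arXiv:2403.08595 — 2 statements merged into one kernel-verified Lean document; each statement's English description precedes it below -/
import Mathlib

section
/- Let A be an algebra over the field F where F is the center of A and F contains at least four elements, such that every finite subset of A is contained in some F-subalgebra of A that is a simple artinian ring. Let G be a non-abelian subnormal subgroup of the group of units A^×, and let ⋆ be an involution of the first kind on A. Then the following are equivalent: (1) g + g^⋆ ∈ F for every g ∈ G; (2) x + x^⋆ ∈ F for every x ∈ A; (3) x·x^⋆ ∈ F for every x ∈ A; (4) g·g^⋆ ∈ F for every g ∈ G. Moreover, if one of these conditions holds, then either (i) A is a quaternion division algebra over F (a division ring with center F and dim_F A = 4), or (ii) there is an F-algebra isomorphism e : A ≅ M_2(F) such that e(x^⋆) = adjugate(e(x)) for every x ∈ A. -/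
/-- A subgroup `G` of a group `Γ` is subnormal if there is a finite chain of
subgroups `G = G_r ⊴ G_{r-1} ⊴ ⋯ ⊴ G_0 = Γ` in which each term is a normal
subgroup of the next. -/
def Subgroup.IsSubnormal' {Γ : Type*} [Group Γ] (G : Subgroup Γ) : Prop :=
  ∃ (r : ℕ) (c : Fin (r + 1) → Subgroup Γ), c 0 = G ∧ c (Fin.last r) = ⊤ ∧
    ∀ i : Fin r, c i.castSucc ≤ c i.succ ∧
      ∀ h ∈ c i.castSucc, ∀ g ∈ c i.succ, g * h * g⁻¹ ∈ c i.castSucc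

section Subnormal

variable {Γ : Type*} [Group Γ]

/-- `H` is subnormal through a chain of `d` steps. -/
def SubnormalOfDepth : ℕ → Subgroup Γ → Prop
  | 0, H => H = ⊤
  | n + 1, H => ∃ K, SubnormalOfDepth n K ∧ H ≤ K ∧ ∀ h ∈ H, ∀ g ∈ K, g * h * g⁻¹ ∈ H

/-- A subgroup that contains two non-commuting elements. -/
def Subgroup.NonAbelian (H : Subgroup Γ) : Prop := ∃ a ∈ H, ∃ b ∈ H, a * b ≠ b * a

/-- The iterated derived subgroups of a subgroup, as subgroups of the ambient group. -/
def Subgroup.iterDerived (H : Subgroup Γ) : ℕ → Subgroup Γ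
  | 0 => H
  | n + 1 => ⁅H.iterDerived n, H.iterDerived n⁆

theorem Subgroup.IsSubnormal'.exists_depth {G : Subgroup Γ} (h : G.IsSubnormal') :
    ∃ d, SubnormalOfDepth d G := by
  obtain ⟨r, c, h0, hl, hc⟩ := h
  subst h0
  induction r with
  | zero => exact ⟨0, hl⟩
  | succ r ih =>
    obtain ⟨d, hd⟩ := ih (fun i => c i.succ) (by simpa using hl)
      (fun i => by simpa using hc i.succ)
    exact ⟨d + 1, _, hd, by simpa using hc 0⟩

theorem SubnormalOfDepth.inf {d e : ℕ} {H K : Subgroup Γ} (hH : SubnormalOfDepth d H)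
    (hK : SubnormalOfDepth e K) : SubnormalOfDepth (e + d) (H ⊓ K) := by
  induction d generalizing H with
  | zero =>
    have : H = ⊤ := hH
    simpa [this] using hK
  | succ n ih =>
    obtain ⟨L, hL, hle, hn⟩ := hH
    refine ⟨L ⊓ K, ih hL, inf_le_inf_right _ hle, fun h hh g hg => ?_⟩
    exact ⟨hn h hh.1 g hg.1, K.mul_mem (K.mul_mem hg.2 hh.2) (K.inv_mem hg.2)⟩

theorem SubnormalOfDepth.comap {Δ : Type*} [Group Δ] (f : Δ →* Γ) {d : ℕ} {H : Subgroup Γ}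
    (hH : SubnormalOfDepth d H) : SubnormalOfDepth d (H.comap f) := by
  induction d generalizing H with
  | zero =>
    have : H = ⊤ := hH
    subst this
    exact Subgroup.comap_top f
  | succ n ih =>
    obtain ⟨L, hL, hle, hn⟩ := hH
    refine ⟨L.comap f, ih hL, Subgroup.comap_mono hle, fun h hh g hg => ?_⟩
    simpa using hn _ hh _ hg

theorem conj_mem_commutator {H K : Subgroup Γ} (hn : ∀ h ∈ H, ∀ g ∈ K, g * h * g⁻¹ ∈ H) :
    ∀ h ∈ ⁅H, H⁆, ∀ g ∈ K, g * h * g⁻¹ ∈ ⁅H, H⁆ := by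
  intro h hh g hg
  have : (⁅H, H⁆).map (MulAut.conj g).toMonoidHom ≤ ⁅H, H⁆ := by
    rw [Subgroup.map_commutator]
    have : H.map (MulAut.conj g).toMonoidHom ≤ H := by
      rintro _ ⟨x, hx, rfl⟩
      exact hn x hx g hg
    exact Subgroup.commutator_mono this this
  exact this ⟨h, hh, rfl⟩

theorem SubnormalOfDepth.commutator {d : ℕ} {H : Subgroup Γ} (hH : SubnormalOfDepth d H) :
    SubnormalOfDepth (d + 1) ⁅H, H⁆ := by
  refine ⟨H, hH, Subgroup.commutator_le.2 fun a ha b hb => ?_, conj_mem_commutator ?_⟩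
  · exact H.mul_mem (H.mul_mem (H.mul_mem ha hb) (H.inv_mem ha)) (H.inv_mem hb)
  · exact fun h hh g hg => H.mul_mem (H.mul_mem hg hh) (H.inv_mem hg)

theorem commutator_self_le (H : Subgroup Γ) : ⁅H, H⁆ ≤ H :=
  Subgroup.commutator_le.2 fun _ ha _ hb =>
    H.mul_mem (H.mul_mem (H.mul_mem ha hb) (H.inv_mem ha)) (H.inv_mem hb)

theorem Subgroup.NonAbelian.mono {H K : Subgroup Γ} (h : H.NonAbelian) (hle : H ≤ K) :
    K.NonAbelian := by
  obtain ⟨a, ha, b, hb, hab⟩ := h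
  exact ⟨a, hle ha, b, hle hb, hab⟩

theorem Subgroup.not_nonAbelian_iff {H : Subgroup Γ} :
    ¬ H.NonAbelian ↔ ∀ a ∈ H, ∀ b ∈ H, a * b = b * a := by
  simp [Subgroup.NonAbelian]

theorem SubnormalOfDepth.iterDerived {d : ℕ} {H : Subgroup Γ} (hH : SubnormalOfDepth d H)
    (n : ℕ) : SubnormalOfDepth (d + n) (H.iterDerived n) := by
  induction n with
  | zero => exact hH
  | succ n ih => exact ih.commutator

theorem Subgroup.iterDerived_succ_le (H : Subgroup Γ) (n : ℕ) :
    H.iterDerived (n + 1) ≤ H.iterDerived n := commutator_self_le _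

theorem Subgroup.iterDerived_le (H : Subgroup Γ) (n : ℕ) : H.iterDerived n ≤ H := by
  induction n with
  | zero => exact le_rfl
  | succ n ih => exact (H.iterDerived_succ_le n).trans ih

theorem iterate_commutator_mem {d : ℕ} {X : Subgroup Γ} (hX : SubnormalOfDepth d X) {x : Γ}
    (hx : x ∈ X) (u : Γ) : (fun u : Γ => u * x * u⁻¹ * x⁻¹)^[d] u ∈ X := by
  induction d generalizing X with
  | zero =>
    have : X = ⊤ := hX
    simp [this]
  | succ n ih =>
    obtain ⟨K, hK, hle, hn⟩ := hX
    rw [Function.iterate_succ_apply']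
    exact X.mul_mem (hn x hx _ (ih hK (hle hx))) (X.inv_mem hx)

end Subnormal

section BoundedEngel

universe u

/-- Numerator and denominator of the `n`-fold commutator of `1 + T` with an element that
conjugates `T` to `q * T`. -/
def engelPair {R : Type*} [Ring R] (q : R) : ℕ → R → R × R
  | 0, T => (1 + T, 1)
  | n + 1, T => ((engelPair q n T).1 * (engelPair q n (q * T)).2,
      (engelPair q n T).2 * (engelPair q n (q * T)).1)

theorem engelPair_map {R S : Type*} [Ring R] [Ring S] (f : R →+* S) (q : R) (n : ℕ) (T : R) :
    engelPair (f q) n (f T) = (f (engelPair q n T).1, f (engelPair q n T).2) := by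
  induction n generalizing T with
  | zero => simp [engelPair]
  | succ n ih => simp [engelPair, ih, ← map_mul]

open Polynomial in
theorem engelPair_coeff {L : Type*} [CommRing L] (q : L) (n : ℕ) (a : L) :
    (engelPair (C q) n (C a * X : L[X])).1.coeff 0 = 1 ∧
    (engelPair (C q) n (C a * X : L[X])).2.coeff 0 = 1 ∧
    (engelPair (C q) n (C a * X : L[X])).1.coeff 1 -
      (engelPair (C q) n (C a * X : L[X])).2.coeff 1 = a * (1 - q) ^ n := by
  induction n generalizing a with
  | zero => simp [engelPair, coeff_one]
  | succ n ih =>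
    have e : (C q * (C a * X) : L[X]) = C (q * a) * X := by simp [mul_assoc]
    obtain ⟨h1, h2, h3⟩ := ih a
    obtain ⟨k1, k2, k3⟩ := ih (q * a)
    simp only [engelPair, e, mul_coeff_zero, mul_coeff_one, h1, h2, k1, k2]
    refine ⟨by simp, by simp, ?_⟩
    linear_combination h3 - k3

open Polynomial in
theorem exists_engelPair_ne {L : Type*} [CommRing L] [IsDomain L] {q : L} (hq : q ≠ 1) (n : ℕ)
    {S : Set L} (hS : S.Infinite) : ∃ T ∈ S, (engelPair q n T).1 ≠ (engelPair q n T).2 := by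
  by_contra! h
  obtain ⟨-, -, h3⟩ := engelPair_coeff q n (1 : L)
  rw [C_1, one_mul] at h3
  have h0 : (engelPair (C q) n (X : L[X])).1 - (engelPair (C q) n (X : L[X])).2 = 0 := by
    refine eq_zero_of_infinite_isRoot _ (hS.mono fun T hT => ?_)
    have h4 := engelPair_map (evalRingHom T) (C q) n X
    simp only [coe_evalRingHom, eval_C, eval_X] at h4
    have h5 := h T hT
    rw [h4] at h5
    simp only [Set.mem_ofPred_eq, IsRoot, eval_sub]
    exact sub_eq_zero.2 h5
  rw [← coeff_sub, h0] at h3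
  simp only [coeff_zero, one_mul] at h3
  exact hq (sub_eq_zero.1 (eq_zero_of_pow_eq_zero h3.symm)).symm

theorem exists_commDomain {D : Type u} [DivisionRing D] {s : Set D}
    (hs : ∀ x ∈ s, ∀ y ∈ s, x * y = y * x) :
    ∃ (L : Type u) (_ : CommRing L) (_ : IsDomain L) (f : L →+* D),
      Function.Injective f ∧ s ⊆ Set.range f := by
  have := Subring.isMulCommutative_closure hs
  refine ⟨Subring.closure s,
    { (inferInstance : Ring (Subring.closure s)) with mul_comm := this.is_comm.comm }, ?_, (Subring.closure s).subtype,
    Subtype.val_injective, fun x hx => ⟨⟨x, Subring.subset_closure hx⟩, rfl⟩⟩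
  have : NoZeroDivisors (Subring.closure s) :=
    Function.Injective.noZeroDivisors (Subring.closure s).subtype Subtype.val_injective
      (map_zero _) (map_mul _)
  have : Nontrivial (Subring.closure s) := inferInstance
  exact NoZeroDivisors.to_isDomain _

theorem exists_engelPair_ne_of_comm {D : Type*} [DivisionRing D] {q : D} (hq : q ≠ 1) (n : ℕ)
    {S : Set D} (hS : S.Infinite) (hc : ∀ x ∈ S, ∀ y ∈ S, x * y = y * x)
    (hqc : ∀ x ∈ S, x * q = q * x) :
    ∃ T ∈ S, (∀ m a b, Commute (engelPair q m (q ^ a * T)).1 (engelPair q m (q ^ b * T)).2 ∧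
      Commute (engelPair q m (q ^ a * T)).2 (engelPair q m (q ^ b * T)).2) ∧
      (engelPair q n T).1 ≠ (engelPair q n T).2 := by
  obtain ⟨L, _, _, f, hf, hsf⟩ := exists_commDomain (s := insert q S) (by
    rintro x (rfl | hx) y (rfl | hy)
    · rfl
    · exact (hqc y hy).symm
    · exact hqc x hx
    · exact hc x hx y hy)
  obtain ⟨q', rfl⟩ := hsf (Set.mem_insert _ _)
  have hq' : q' ≠ 1 := fun h => hq (by rw [h, map_one])
  have hS' : (f ⁻¹' S).Infinite := hS.preimage fun x hx => hsf (Set.mem_insert_of_mem _ hx)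
  obtain ⟨T, hT, hne⟩ := exists_engelPair_ne hq' n hS'
  refine ⟨f T, hT, fun m a b => ?_, ?_⟩
  · simp only [← map_pow, ← map_mul, engelPair_map]
    exact ⟨(Commute.all _ _).map f, (Commute.all _ _).map f⟩
  · rw [engelPair_map]
    exact fun h => hne (hf h)

theorem conj_engelPair {D : Type*} [DivisionRing D] {q x : D} (hxq : x * q = q * x) (n : ℕ)
    {T : D} (hT : x * T = q * T * x) :
    x * (engelPair q n T).1 = (engelPair q n (q * T)).1 * x ∧
    x * (engelPair q n T).2 = (engelPair q n (q * T)).2 * x := by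
  induction n generalizing T with
  | zero => simp [engelPair, mul_add, add_mul, hT]
  | succ n ih =>
    have hT' : x * (q * T) = q * (q * T) * x := by
      rw [← mul_assoc, hxq, mul_assoc, hT]; simp only [mul_assoc]
    obtain ⟨h1, h2⟩ := ih hT
    obtain ⟨h3, h4⟩ := ih hT'
    simp only [engelPair]
    constructor
    · rw [← mul_assoc, h1, mul_assoc, h4, mul_assoc]
    · rw [← mul_assoc, h2, mul_assoc, h3, mul_assoc]

theorem iterate_commutator_mul_engelPair {D : Type*} [DivisionRing D] {q T : D} {x : Dˣ}
    (hxq : (x : D) * q = q * x) (hT : (x : D) * T = q * T * x)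
    (hcomm : ∀ m a b, Commute (engelPair q m (q ^ a * T)).1 (engelPair q m (q ^ b * T)).2 ∧
      Commute (engelPair q m (q ^ a * T)).2 (engelPair q m (q ^ b * T)).2)
    (u : Dˣ) (hu : (u : D) = 1 + T) (n : ℕ) :
    (((fun u : Dˣ => u * x * u⁻¹ * x⁻¹)^[n] u : Dˣ) : D) * (engelPair q n T).2 =
      (engelPair q n T).1 := by
  induction n with
  | zero => simp [engelPair, hu]
  | succ n ih =>
    rw [Function.iterate_succ_apply']
    set v := (fun u : Dˣ => u * x * u⁻¹ * x⁻¹)^[n] u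
    obtain ⟨h1, h2⟩ := conj_engelPair hxq n hT
    have c1 := (hcomm n 1 0).1
    have c2 := (hcomm n 0 1).2
    simp only [pow_zero, one_mul, pow_one] at c1 c2
    have h3 : ((x * v * x⁻¹ : Dˣ) : D) * (engelPair q n (q * T)).2 =
        (engelPair q n (q * T)).1 := by
      have : (x : D) * (v * (engelPair q n T).2) = (engelPair q n (q * T)).1 * x := by rw [ih, h1]
      have h5 : (engelPair q n (q * T)).2 = x * (engelPair q n T).2 * ((x⁻¹ : Dˣ) : D) := by
        rw [h2, mul_assoc, Units.mul_inv, mul_one]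
      rw [h5, Units.val_mul, Units.val_mul]
      calc (x : D) * v * ((x⁻¹ : Dˣ) : D) * (x * (engelPair q n T).2 * ((x⁻¹ : Dˣ) : D))
          = x * (v * (engelPair q n T).2) * ((x⁻¹ : Dˣ) : D) := by
            simp only [mul_assoc, Units.inv_mul_cancel_left]
        _ = _ := by rw [this, mul_assoc, Units.mul_inv, mul_one]
    have h4 : v * x * v⁻¹ * x⁻¹ * (x * v * x⁻¹) = v := by group
    simp only [engelPair]
    rw [← c1.eq, ← h3, ← mul_assoc, ← mul_assoc, ← Units.val_mul, h4, mul_assoc, ← c2.eq,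
      ← mul_assoc, ih]

end BoundedEngel

section AbelianSubnormal

theorem exists_infinite_powers {D : Type*} [DivisionRing D] {x y u : Dˣ} (hux : u * x = x * u)
    (huy : u * y = y * u) (hu : ¬ IsOfFinOrder u) :
    ∃ S : Set D, S.Infinite ∧ (∀ s ∈ S, ∀ t ∈ S, s * t = t * s) ∧
      ∀ s ∈ S, s * x = x * s ∧ s * y = y * s := by
  refine ⟨Set.range fun n : ℕ => ((u ^ n : Dˣ) : D), Set.infinite_range_of_injective ?_, ?_, ?_⟩
  · exact Units.val_injective.comp (injective_pow_iff_not_isOfFinOrder.2 hu)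
  · rintro _ ⟨m, rfl⟩ _ ⟨n, rfl⟩
    simp only [← Units.val_mul, ← pow_add, add_comm]
  · rintro _ ⟨m, rfl⟩
    simp only [← Units.val_mul]
    exact ⟨congrArg _ ((show Commute u x from hux).pow_left m).eq,
      congrArg _ ((show Commute u y from huy).pow_left m).eq⟩

theorem commute_of_isOfFinOrder {D : Type*} [DivisionRing D] {p : ℕ} [Fact p.Prime] [CharP D p]
    {x y q : Dˣ} (hxy : x * y = q * (y * x)) (hxq : x * q = q * x) (hyq : y * q = q * y)
    (hx : IsOfFinOrder x) (hy : IsOfFinOrder y) (hq : IsOfFinOrder q) : x * y = y * x := by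
  let _ := ZMod.algebra D p
  have key1 : ∀ k : ℕ, x ^ k * y = q ^ k * (y * x ^ k) := by
    intro k
    induction k with
    | zero => simp
    | succ k ih =>
      have hc : x ^ k * q = q * x ^ k := ((show Commute x q from hxq).pow_left k).eq
      calc x ^ (k + 1) * y = x ^ k * q * (y * x) := by rw [pow_succ, mul_assoc, hxy, mul_assoc]
        _ = q * (x ^ k * y) * x := by rw [hc]; simp only [mul_assoc]
        _ = q ^ (k + 1) * (y * x ^ (k + 1)) := by
          rw [ih, pow_succ' q, pow_succ x]; simp only [mul_assoc]
  have key : ∀ j k : ℕ, x ^ k * y ^ j = q ^ (k * j) * (y ^ j * x ^ k) := by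
    intro j k
    induction j with
    | zero => simp
    | succ j ih =>
      have hc : y ^ j * q ^ k = q ^ k * y ^ j := ((show Commute y q from hyq).pow_pow j k).eq
      calc x ^ k * y ^ (j + 1) = x ^ k * y ^ j * y := by rw [pow_succ, mul_assoc]
        _ = q ^ (k * j) * (y ^ j * (x ^ k * y)) := by rw [ih]; simp only [mul_assoc]
        _ = q ^ (k * j) * (y ^ j * q ^ k * (y * x ^ k)) := by rw [key1]; simp only [mul_assoc]
        _ = q ^ (k * (j + 1)) * (y ^ (j + 1) * x ^ k) := by
          rw [hc, mul_add, mul_one, pow_add, pow_succ y]; simp only [mul_assoc]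
  let M : Submonoid D :=
    { carrier := {d | ∃ i j k : ℕ, ((q ^ i * (y ^ j * x ^ k) : Dˣ) : D) = d}
      one_mem' := ⟨0, 0, 0, by simp⟩
      mul_mem' := by
        rintro _ _ ⟨i, j, k, rfl⟩ ⟨i', j', k', rfl⟩
        refine ⟨i + i' + k * j', j + j', k + k', ?_⟩
        rw [← Units.val_mul]
        congr 1
        have h1 : y ^ j * q ^ i' = q ^ i' * y ^ j :=
          ((show Commute y q from hyq).pow_pow j i').eq
        have h2 : x ^ k * q ^ i' = q ^ i' * x ^ k :=
          ((show Commute x q from hxq).pow_pow k i').eq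
        have h3 : y ^ j * q ^ (k * j') = q ^ (k * j') * y ^ j :=
          ((show Commute y q from hyq).pow_pow j (k * j')).eq
        symm
        calc q ^ i * (y ^ j * x ^ k) * (q ^ i' * (y ^ j' * x ^ k'))
            = q ^ i * (y ^ j * ((x ^ k * q ^ i') * (y ^ j' * x ^ k'))) := by
              simp only [mul_assoc]
          _ = q ^ i * ((y ^ j * q ^ i') * ((x ^ k * y ^ j') * x ^ k')) := by
              rw [h2]; simp only [mul_assoc]
          _ = q ^ i * (q ^ i' * ((y ^ j * q ^ (k * j')) * (y ^ j' * (x ^ k * x ^ k')))) := by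
              rw [h1, key]; simp only [mul_assoc]
          _ = q ^ (i + i' + k * j') * (y ^ (j + j') * x ^ (k + k')) := by
              rw [h3]; simp only [pow_add, mul_assoc] }
  have hM : (M : Set D).Finite := by
    have h1 : ((Submonoid.powers q : Set Dˣ) ×ˢ ((Submonoid.powers y : Set Dˣ) ×ˢ
        (Submonoid.powers x : Set Dˣ))).Finite :=
      hq.finite_powers.prod (hy.finite_powers.prod hx.finite_powers)
    refine (h1.image fun t => ((t.1 * (t.2.1 * t.2.2) : Dˣ) : D)).subset ?_
    rintro _ ⟨i, j, k, rfl⟩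
    exact ⟨(q ^ i, y ^ j, x ^ k), ⟨⟨i, rfl⟩, ⟨j, rfl⟩, ⟨k, rfl⟩⟩, rfl⟩
  set B := Algebra.adjoin (ZMod p) (M : Set D)
  have hB : Finite B := by
    have h1 : Subalgebra.toSubmodule B = Submodule.span (ZMod p) (M : Set D) := by
      rw [Algebra.adjoin_eq_span, Submonoid.closure_eq]
    have h2 : Module.Finite (ZMod p) (Submodule.span (ZMod p) (M : Set D)) :=
      FiniteDimensional.span_of_finite _ hM
    rw [← h1] at h2
    have h3 := Module.finite_of_finite (ZMod p) (M := Subalgebra.toSubmodule B)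
    exact h3
  have : IsDomain B := inferInstance
  have hxM : (x : D) ∈ M := ⟨0, 0, 1, by simp⟩
  have hyM : (y : D) ∈ M := ⟨0, 1, 0, by simp⟩
  have h5 := (Finite.isDomain_to_isField B).mul_comm ⟨x, Algebra.subset_adjoin hxM⟩
    ⟨y, Algebra.subset_adjoin hyM⟩
  ext
  simpa using congrArg Subtype.val h5

theorem exists_infinite_commuting {D : Type*} [DivisionRing D] {x y q : Dˣ} (hne : x * y ≠ y * x)
    (hxy : x * y = q * (y * x)) (hxq : x * q = q * x) (hyq : y * q = q * y) :
    ∃ S : Set D, S.Infinite ∧ (∀ s ∈ S, ∀ t ∈ S, s * t = t * s) ∧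
      ∀ s ∈ S, s * x = x * s ∧ s * y = y * s := by
  obtain ⟨p, hp⟩ := CharP.exists D
  rcases CharP.char_is_prime_or_zero D p with hpp | rfl
  swap
  · have : CharZero D := CharP.charP_to_charZero D
    refine ⟨Set.range fun n : ℕ => (n : D), Set.infinite_range_of_injective Nat.cast_injective,
      ?_, ?_⟩
    · rintro _ ⟨m, rfl⟩ _ ⟨n, rfl⟩
      exact Nat.cast_commute m _
    · rintro _ ⟨m, rfl⟩
      exact ⟨Nat.cast_commute m _, Nat.cast_commute m _⟩
  have : Fact p.Prime := ⟨hpp⟩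
  by_cases hq : IsOfFinOrder q
  swap
  · exact exists_infinite_powers hxq.symm hyq.symm hq
  obtain ⟨m, hm, hqm⟩ := isOfFinOrder_iff_pow_eq_one.1 hq
  have hcx : SemiconjBy y x (q⁻¹ * x) := by
    rw [SemiconjBy, mul_assoc, hxy, inv_mul_cancel_left]
  have hcy : SemiconjBy x y (q * y) := by
    rw [SemiconjBy, hxy, mul_assoc]
  have hx' : x ^ m * y = y * x ^ m := by
    have := hcx.pow_right m
    rw [((show Commute x q from hxq).symm.inv_left).mul_pow, inv_pow, hqm] at this
    simpa using this.eq.symm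
  have hy' : y ^ m * x = x * y ^ m := by
    have := hcy.pow_right m
    rw [(show Commute y q from hyq).symm.mul_pow, hqm] at this
    simpa using this.eq.symm
  by_cases hx : IsOfFinOrder x
  swap
  · exact exists_infinite_powers (u := x ^ m) (Commute.self_pow x m).symm.eq hx'
      (fun h => hx (h.of_pow hm.ne'))
  by_cases hy : IsOfFinOrder y
  swap
  · exact exists_infinite_powers (u := y ^ m) hy' (Commute.self_pow y m).symm.eq
      (fun h => hy (h.of_pow hm.ne'))
  exact absurd (commute_of_isOfFinOrder (p := p) hxy hxq hyq hx hy hq) hne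

/-- No element of a division ring that is bounded left Engel can commute with its commutator
with some element without commuting with that element. -/
theorem exists_iterate_commutator_ne_one {D : Type*} [DivisionRing D] {x y q : Dˣ}
    (hne : x * y ≠ y * x) (hxy : x * y = q * (y * x)) (hxq : x * q = q * x)
    (hyq : y * q = q * y) (n : ℕ) :
    ∃ u : Dˣ, (fun u : Dˣ => u * x * u⁻¹ * x⁻¹)^[n] u ≠ 1 := by
  obtain ⟨S, hS, hSc, hSxy⟩ := exists_infinite_commuting hne hxy hxq hyq
  have hq1 : (q : D) ≠ 1 := fun h => hne (by rw [hxy, Units.ext (v := 1) h, one_mul])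
  have hq : q = x * y * x⁻¹ * y⁻¹ := by rw [hxy]; group
  have hSq : ∀ s ∈ S, Commute s q := by
    intro s hs
    rw [hq]
    have h1 : Commute s x := (hSxy s hs).1
    have h2 : Commute s y := (hSxy s hs).2
    simp only [Units.val_mul]
    exact ((h1.mul_right h2).mul_right h1.units_inv_right).mul_right h2.units_inv_right
  have hinf : ((fun s => s * (y : D)) '' (S \ {-((y⁻¹ : Dˣ) : D)})).Infinite :=
    (hS.sdiff (Set.finite_singleton _)).image (fun a _ b _ h => (Units.mul_left_inj y).1 h)
  have hyq' : Commute (y : D) q := congrArg Units.val hyq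
  obtain ⟨_, ⟨s, ⟨hs, hs1⟩, rfl⟩, hcomm, hneq⟩ := exists_engelPair_ne_of_comm hq1 n hinf
    (by
      rintro _ ⟨s, ⟨hs, -⟩, rfl⟩ _ ⟨t, ⟨ht, -⟩, rfl⟩
      have h1 : Commute s t := hSc s hs t ht
      have h2 : Commute s y := (hSxy s hs).2
      have h3 : Commute t y := (hSxy t ht).2
      exact ((h1.mul_right h2).mul_left (h3.symm.mul_right (Commute.refl _))).eq)
    (by
      rintro _ ⟨s, ⟨hs, -⟩, rfl⟩
      exact ((hSq s hs).mul_left hyq').eq)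
  have hu : (1 : D) + s * y ≠ 0 := by
    intro h
    apply hs1
    rw [Set.mem_singleton_iff, ← mul_one s, ← Units.mul_inv y, ← mul_assoc,
      ← neg_eq_of_add_eq_zero_right h]
    simp
  refine ⟨Units.mk0 _ hu, fun h => hneq ?_⟩
  have h2 := iterate_commutator_mul_engelPair (q := (q : D)) (T := s * (y : D)) (x := x)
    (congrArg Units.val hxq)
    (by
      have h1 := (hSxy s hs).1
      have h3 : (x : D) * y = q * (y * x) := by simpa using congrArg Units.val hxy
      rw [← mul_assoc, ← h1, mul_assoc, h3, ← mul_assoc, (hSq s hs).eq]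
      simp only [mul_assoc]) hcomm (Units.mk0 _ hu) rfl n
  rw [h] at h2
  simpa using h2.symm

/-- An abelian subnormal subgroup of the multiplicative group of a division ring is central. -/
theorem SubnormalOfDepth.central {D : Type*} [DivisionRing D] (d : ℕ) (X : Subgroup Dˣ)
    (hX : SubnormalOfDepth d X) (hab : ∀ a ∈ X, ∀ b ∈ X, a * b = b * a) :
    ∀ x ∈ X, ∀ y : Dˣ, x * y = y * x := by
  induction d using Nat.strong_induction_on generalizing X with
  | _ d ih =>
  match d with
  | 0 =>
    have : X = ⊤ := hX
    subst this
    exact fun x hx y => hab x hx y trivial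
  | 1 =>
    obtain ⟨K, hK, -, hn⟩ := hX
    have : K = ⊤ := hK
    subst this
    intro x hx y
    by_contra hne
    have hne' : (x : D) * y ≠ y * x := fun h => hne (Units.ext h)
    have hw : (1 : D) + y ≠ 0 := by
      intro h
      apply hne'
      rw [← neg_eq_of_add_eq_zero_right h]
      simp
    set w := Units.mk0 _ hw
    have h1 := hab x hx _ (hn x hx y trivial)
    have h2 := hab x hx _ (hn x hx w trivial)
    set p := y * x * y⁻¹
    set p' := w * x * w⁻¹
    have hp : (p : D) * y = y * x := by
      rw [← Units.val_mul, ← Units.val_mul]; simp [p]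
    have hp' : (p' : D) * (1 + y) = (1 + y) * x := by
      change ((p' : D) * w) = w * x
      rw [← Units.val_mul, ← Units.val_mul]; simp [p']
    have h3 : ((p' : D) - p) * y = x - p' := by
      linear_combination (norm := noncomm_ring) hp' - hp
    have c1 : Commute (x : D) p := congrArg Units.val h1
    have c2 : Commute (x : D) p' := congrArg Units.val h2
    by_cases h4 : (p' : D) - p = 0
    · rw [h4, zero_mul] at h3
      replace h3 := sub_eq_zero.1 h3.symm
      rw [sub_eq_zero] at h4
      rw [← h4, ← h3] at hp
      exact hne' hp
    · have h5 : (y : D) = ((p' : D) - p)⁻¹ * (x - p') := by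
        rw [← h3, inv_mul_cancel_left₀ h4]
      apply hne'
      rw [h5]
      exact (((c2.sub_right c1).inv_right₀).mul_right ((Commute.refl _).sub_right c2)).eq
  | n + 2 =>
    have hX' := hX
    obtain ⟨Y, ⟨Y', hY', hYY', hn'⟩, hXY, hn⟩ := hX
    by_cases hall : ∀ w ∈ Y', ∀ a ∈ X, ∀ b ∈ X, a * (w * b * w⁻¹) = w * b * w⁻¹ * a
    · set s : Set Dˣ := {u | ∃ w ∈ Y', ∃ b ∈ X, w * b * w⁻¹ = u}
      have hs : ∀ u ∈ s, ∀ v ∈ s, u * v = v * u := by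
        rintro _ ⟨w, hw, a, ha, rfl⟩ _ ⟨w', hw', b, hb, rfl⟩
        have := hall (w⁻¹ * w') (Y'.mul_mem (Y'.inv_mem hw) hw') a ha b hb
        calc w * a * w⁻¹ * (w' * b * w'⁻¹)
            = w * (a * (w⁻¹ * w' * b * (w⁻¹ * w')⁻¹)) * w⁻¹ := by group
          _ = w' * b * w'⁻¹ * (w * a * w⁻¹) := by rw [this]; group
      have hXs : X ≤ Subgroup.closure s := fun x hx =>
        Subgroup.subset_closure ⟨1, Y'.one_mem, x, hx, by simp⟩
      have hsab : ∀ u ∈ Subgroup.closure s, ∀ v ∈ Subgroup.closure s, u * v = v * u := by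
        have := Subgroup.isMulCommutative_closure hs
        intro u hu v hv
        exact congrArg Subtype.val (this.is_comm.comm ⟨u, hu⟩ ⟨v, hv⟩)
      have hsub : SubnormalOfDepth (n + 1) (Subgroup.closure s) := by
        refine ⟨Y', hY', ?_, ?_⟩
        · rw [Subgroup.closure_le]
          rintro _ ⟨w, hw, b, hb, rfl⟩
          exact Y'.mul_mem (Y'.mul_mem hw (hYY' (hXY hb))) (Y'.inv_mem hw)
        · intro h hh g hg
          have h1 : Subgroup.closure s ≤
              (Subgroup.closure s).comap (MulAut.conj g).toMonoidHom := by
            rw [Subgroup.closure_le]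
            rintro _ ⟨w, hw, b, hb, rfl⟩
            exact Subgroup.subset_closure ⟨g * w, Y'.mul_mem hg hw, b, hb, by simp [mul_assoc]⟩
          exact h1 hh
      exact fun x hx => ih (n + 1) (by omega) _ hsub hsab x (hXs hx)
    · exfalso
      push Not at hall
      obtain ⟨w, hw, x, hx, b, hb, hne⟩ := hall
      set y := w * b * w⁻¹
      set q := x * y * x⁻¹ * y⁻¹ with hq
      have hyY : y ∈ Y := hn' b (hXY hb) w hw
      have hq1 : q ∈ X := by
        have : q = x * (y * x⁻¹ * y⁻¹) := by rw [hq]; group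
        rw [this]
        exact X.mul_mem hx (hn _ (X.inv_mem hx) y hyY)
      have hq2 : w⁻¹ * q * w ∈ X := by
        have hx' : w⁻¹ * x * w ∈ Y := by
          simpa using hn' x (hXY hx) w⁻¹ (Y'.inv_mem hw)
        have : w⁻¹ * q * w = (w⁻¹ * x * w) * b * (w⁻¹ * x * w)⁻¹ * b⁻¹ := by
          simp only [hq, y]; group
        rw [this]
        exact X.mul_mem (hn b hb _ hx') (X.inv_mem hb)
      have hyq : y * q = q * y := by
        have := hab b hb _ hq2
        calc y * q = w * (b * (w⁻¹ * q * w)) * w⁻¹ := by simp only [y]; group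
          _ = q * y := by rw [this]; simp only [y]; group
      obtain ⟨u, hu⟩ := exists_iterate_commutator_ne_one hne (q := q) (by rw [hq]; group)
        (hab x hx q hq1) hyq (n + 2 + 1)
      apply hu
      rw [Function.iterate_succ_apply']
      have h1 := iterate_commutator_mem hX' hx u
      rw [← hab x hx _ h1]
      group

/-- The derived subgroup of a non-abelian subnormal subgroup of the multiplicative group of a
division ring is non-abelian. -/
theorem Subgroup.NonAbelian.commutator {D : Type*} [DivisionRing D] {d : ℕ} {H : Subgroup Dˣ}
    (hH : SubnormalOfDepth d H) (hna : H.NonAbelian) : (⁅H, H⁆).NonAbelian := by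
  by_contra hab
  rw [Subgroup.not_nonAbelian_iff] at hab
  have hcen := SubnormalOfDepth.central _ _ hH.commutator hab
  obtain ⟨a, ha, b, hb, hne⟩ := hna
  set C : Subgroup Dˣ := H ⊓ (Subgroup.zpowers a ⊔ Subgroup.center Dˣ)
  have haC : a ∈ C := ⟨ha, Subgroup.mem_sup_left (Subgroup.mem_zpowers a)⟩
  have hCn : ∀ h ∈ C, ∀ g ∈ H, g * h * g⁻¹ ∈ C := by
    rintro h ⟨hh, hh'⟩ g hg
    refine ⟨H.mul_mem (H.mul_mem hg hh) (H.inv_mem hg), ?_⟩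
    have h1 : g * h * g⁻¹ * h⁻¹ ∈ Subgroup.center Dˣ := by
      rw [Subgroup.mem_center_iff]
      intro z
      exact (hcen _ (Subgroup.commutator_mem_commutator hg hh) z).symm
    have h2 : g * h * g⁻¹ = g * h * g⁻¹ * h⁻¹ * h := by group
    rw [h2]
    exact Subgroup.mul_mem _ (Subgroup.mem_sup_right h1) hh'
  have hCab : ∀ u ∈ C, ∀ v ∈ C, u * v = v * u := by
    rintro u ⟨-, hu⟩ v ⟨-, hv⟩
    obtain ⟨_, ⟨i, rfl⟩, z, hz, rfl⟩ := Subgroup.mem_sup_of_normal_right.1 hu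
    obtain ⟨_, ⟨j, rfl⟩, z', hz', rfl⟩ := Subgroup.mem_sup_of_normal_right.1 hv
    rw [Subgroup.mem_center_iff] at hz hz'
    have h1 : Commute (a ^ i) (a ^ j) := (Commute.refl a).zpow_zpow i j
    exact ((h1.mul_right (hz' _)).mul_left (Commute.mul_right (hz _).symm (hz' _))).eq
  exact hne (SubnormalOfDepth.central (d + 1) C ⟨H, hH, inf_le_left, hCn⟩ hCab a haC b)

end AbelianSubnormal

/-- An involution of the first kind, as a bare function. -/
structure IsFirstKindInvolution {A : Type*} [Ring A] (σ : A → A) : Prop where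
  add : ∀ x y, σ (x + y) = σ x + σ y
  mul : ∀ x y, σ (x * y) = σ y * σ x
  invo : ∀ x, σ (σ x) = x
  fix : ∀ x ∈ Subring.center A, σ x = x

namespace IsFirstKindInvolution

variable {A : Type*} [Ring A] {σ : A → A} (hσ : IsFirstKindInvolution σ)

include hσ

theorem map_one : σ 1 = 1 := hσ.fix 1 (Subring.one_mem _)

theorem map_zero : σ 0 = 0 := hσ.fix 0 (Subring.zero_mem _)

theorem map_neg (x : A) : σ (-x) = -σ x := by
  rw [← neg_one_mul x, hσ.mul, hσ.fix (-1) (Subring.neg_mem _ (Subring.one_mem _)), mul_neg_one]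

theorem map_eq_zero {x : A} (h : σ x = 0) : x = 0 := by
  rw [← hσ.invo x, h, hσ.map_zero]

end IsFirstKindInvolution

section DivisionCentralizers

variable {D : Type*} [DivisionRing D]

/-- The centralizer in `D` of a subgroup of `Dˣ`. -/
def cen (X : Subgroup Dˣ) : Subring D := Subring.centralizer (Units.val '' (X : Set Dˣ))

/-- The double centralizer in `D` of a subgroup of `Dˣ`. -/
def dblCen (X : Subgroup Dˣ) : Subring D := Subring.centralizer (cen X : Set D)

theorem mem_cen {X : Subgroup Dˣ} {z : D} : z ∈ cen X ↔ ∀ x ∈ X, Commute (x : D) z := by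
  simp only [cen, Subring.mem_centralizer_iff, Set.forall_mem_image]
  rfl

theorem mem_dblCen {X : Subgroup Dˣ} {q : D} : q ∈ dblCen X ↔ ∀ z ∈ cen X, Commute z q :=
  Subring.mem_centralizer_iff

theorem cen_anti {X Y : Subgroup Dˣ} (h : X ≤ Y) : cen Y ≤ cen X := fun _ hz =>
  mem_cen.2 fun x hx => mem_cen.1 hz x (h hx)

theorem dblCen_mono {X Y : Subgroup Dˣ} (h : X ≤ Y) : dblCen X ≤ dblCen Y := fun _ hq =>
  mem_dblCen.2 fun z hz => mem_dblCen.1 hq z (cen_anti h hz)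

theorem val_mem_dblCen {X : Subgroup Dˣ} {x : Dˣ} (hx : x ∈ X) : (x : D) ∈ dblCen X :=
  mem_dblCen.2 fun _ hz => (mem_cen.1 hz x hx).symm

theorem inv_mem_cen {X : Subgroup Dˣ} {z : D} (hz : z ∈ cen X) : z⁻¹ ∈ cen X :=
  mem_cen.2 fun x hx => (mem_cen.1 hz x hx).inv_right₀

theorem inv_mem_dblCen {X : Subgroup Dˣ} {q : D} (hq : q ∈ dblCen X) : q⁻¹ ∈ dblCen X :=
  mem_dblCen.2 fun z hz => (mem_dblCen.1 hq z hz).inv_right₀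

/-- The units commuting with a given element. -/
def unitsCommuting (z : D) : Subgroup Dˣ where
  carrier := {u | Commute (u : D) z}
  one_mem' := Commute.one_left z
  mul_mem' := fun ha hb => by
    have := Commute.mul_left ha hb
    simpa using this
  inv_mem' := fun ha => Commute.units_inv_left ha

theorem mem_cen_iff_le {X : Subgroup Dˣ} {z : D} : z ∈ cen X ↔ X ≤ unitsCommuting z := mem_cen

theorem mem_cen_commutator {X : Subgroup Dˣ} {z : D}
    (h : ∀ x ∈ X, ∀ y ∈ X, Commute ((x * y * x⁻¹ * y⁻¹ : Dˣ) : D) z) : z ∈ cen ⁅X, X⁆ := by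
  rw [mem_cen_iff_le, Subgroup.commutator_le]
  exact h

/-- The elements of `X` have central norm. -/
def NormCentral (σ : D → D) (X : Subgroup Dˣ) : Prop :=
  ∀ x ∈ X, ∀ y : D, Commute ((x : D) * σ x) y

variable {σ : D → D} (hσ : IsFirstKindInvolution σ)

include hσ

theorem involution_mem_cen {X : Subgroup Dˣ} (hX : NormCentral σ X) {z : D} (hz : z ∈ cen X) :
    σ z ∈ cen X := by
  rw [mem_cen] at hz ⊢
  intro x hx
  have h0 : σ x ≠ 0 := fun h => x.ne_zero (hσ.map_eq_zero h)
  have h1 : Commute (σ x) (σ z) := by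
    rw [Commute, SemiconjBy, ← hσ.mul, ← hσ.mul, (hz x hx).eq]
  have h2 : (x : D) = x * σ x * (σ x)⁻¹ := by rw [mul_assoc, mul_inv_cancel₀ h0, mul_one]
  rw [h2]
  exact (hX x hx _).mul_left h1.inv_left₀

theorem involution_mem_dblCen {X : Subgroup Dˣ} (hX : NormCentral σ X) {q : D}
    (hq : q ∈ dblCen X) : σ q ∈ dblCen X := by
  rw [mem_dblCen] at hq ⊢
  intro z hz
  have h1 := (hq _ (involution_mem_cen hσ hX hz)).eq
  have h2 := congrArg σ h1
  rw [hσ.mul, hσ.mul, hσ.invo] at h2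
  exact h2.symm

theorem norm_mem_cen_step {G K K' : Subgroup Dˣ} (hG : NormCentral σ G) (hGK : G ≤ K)
    (hn : ∀ h ∈ K, ∀ g ∈ K', g * h * g⁻¹ ∈ K)
    (hK : ∀ w ∈ K, (w : D) ∈ dblCen G → σ w * w ∈ cen G) :
    ∀ w ∈ K', (w : D) ∈ dblCen ⁅G, G⁆ → σ w * w ∈ cen ⁅G, G⁆ := by
  intro w hw hwQ
  have hwQ := dblCen_mono (commutator_self_le G) hwQ
  set z := σ w * w with hz
  have hσw : σ w ∈ dblCen G := involution_mem_dblCen hσ hG hwQ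
  have hσw0 : σ w ≠ 0 := fun h => w.ne_zero (hσ.map_eq_zero h)
  have hz0 : z ≠ 0 := mul_ne_zero hσw0 w.ne_zero
  have hzQ : z ∈ dblCen G := (dblCen G).mul_mem hσw hwQ
  have key : ∀ v ∈ G, ∃ μ : D, μ ∈ cen G ∧ μ ≠ 0 ∧ μ ∈ dblCen G ∧ z * v = μ * (v * z) := by
    intro v hv
    have hvQ := val_mem_dblCen hv
    set u := w * v * w⁻¹ with hu
    have huQ : (u : D) ∈ dblCen G := by
      rw [hu, Units.val_mul, Units.val_mul, Units.val_inv_eq_inv_val]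
      exact mul_mem (mul_mem hwQ hvQ) (inv_mem_dblCen hwQ)
    have hβ := hK u (hn v (hGK hv) w hw) huQ
    set β := σ u * u with hβdef
    have hβQ : β ∈ dblCen G := (dblCen G).mul_mem (involution_mem_dblCen hσ hG huQ) huQ
    have hβ0 : β ≠ 0 := mul_ne_zero (fun h => u.ne_zero (hσ.map_eq_zero h)) u.ne_zero
    have hc := hG v hv
    set c := (v : D) * σ v with hcdef
    have hσv0 : σ v ≠ 0 := fun h => v.ne_zero (hσ.map_eq_zero h)
    have hc0 : c ≠ 0 := mul_ne_zero v.ne_zero hσv0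
    have huw : (u : D) * w = w * v := by
      rw [← Units.val_mul, ← Units.val_mul]; simp [hu]
    have huw' : σ w * σ u = σ v * σ w := by rw [← hσ.mul, huw, hσ.mul]
    have h1 : σ w * β * w = σ v * z * v := by
      calc σ w * β * w = (σ w * σ u) * (u * w) := by rw [hβdef]; simp only [mul_assoc]
        _ = σ v * z * v := by rw [huw, huw', hz]; simp only [mul_assoc]
    have h2 : σ w * β = β * σ w := (mem_dblCen.1 hσw β hβ).eq.symm
    have h3 : v * (β * z) = c * (z * v) := by
      rw [h2, mul_assoc, ← hz] at h1
      rw [h1, hcdef]; simp only [mul_assoc]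
    have hcG : c⁻¹ ∈ cen G := mem_cen.2 fun x _ => (hc x).symm.inv_right₀
    have hcQ : c⁻¹ ∈ dblCen G := mem_dblCen.2 fun x _ => (hc x).symm.inv_right₀
    refine ⟨c⁻¹ * β, mul_mem hcG hβ, mul_ne_zero (inv_ne_zero hc0) hβ0, mul_mem hcQ hβQ, ?_⟩
    have h4 : β * (v * z) = v * (β * z) := by
      rw [← mul_assoc, ← (mem_cen.1 hβ v hv).eq, mul_assoc]
    rw [mul_assoc c⁻¹ β, h4, h3, inv_mul_cancel_left₀ hc0]
  clear_value z
  refine mem_cen_commutator fun v₁ hv₁ v₂ hv₂ => ?_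
  obtain ⟨μ₁, hμ₁, hμ₁0, hμ₁Q, h1⟩ := key v₁ hv₁
  obtain ⟨μ₂, hμ₂, hμ₂0, hμ₂Q, h2⟩ := key v₂ hv₂
  have hcomm : Commute μ₁ μ₂ := mem_dblCen.1 hμ₂Q μ₁ hμ₁
  have key2 : ∀ {a b : Dˣ} {α β : D}, a ∈ G → α ∈ cen G → β ∈ cen G → z * a = α * (a * z) →
      z * b = β * (b * z) → z * (a * b) = α * β * (a * b * z) := by
    intro a b α β ha hα hβ h h'
    rw [← mul_assoc, h, mul_assoc, mul_assoc, h', ← mul_assoc (a : D), (mem_cen.1 hβ a ha).eq]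
    simp only [mul_assoc]
  have h12 := key2 hv₁ hμ₁ hμ₂ h1 h2
  have h21 := key2 hv₂ hμ₂ hμ₁ h2 h1
  have hμ0 : μ₁ * μ₂ ≠ 0 := mul_ne_zero hμ₁0 hμ₂0
  have hμ : Commute (μ₁ * μ₂) z := mem_dblCen.1 hzQ _ (mul_mem hμ₁ hμ₂)
  set s : Dˣ := v₁ * v₂
  set t : Dˣ := v₂ * v₁
  rw [← hcomm.eq] at h21
  set μ := μ₁ * μ₂
  have hst : v₁ * v₂ * v₁⁻¹ * v₂⁻¹ = s * t⁻¹ := by simp only [s, t]; group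
  rw [hst]
  have hμs : Commute (s : D) μ := mem_cen.1 (mul_mem hμ₁ hμ₂) s (G.mul_mem hv₁ hv₂)
  have hs : z * s = μ * (s * z) := by simpa [s] using h12
  have ht : z * t = μ * (t * z) := by simpa [t] using h21
  have ht' : ((t⁻¹ : Dˣ) : D) * z = μ * z * ((t⁻¹ : Dˣ) : D) := by
    have hμt : Commute (t : D) μ := mem_cen.1 (mul_mem hμ₁ hμ₂) t (G.mul_mem hv₂ hv₁)
    have : (t : D) * (((t⁻¹ : Dˣ) : D) * z) * t = t * (μ * z * ((t⁻¹ : Dˣ) : D)) * t := by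
      rw [Units.mul_inv_cancel_left, ht]
      rw [mul_assoc (t : D), mul_assoc (μ * z), Units.inv_mul, mul_one, ← mul_assoc (t : D), hμt.eq]
      exact (mul_assoc μ _ _).symm
    exact (Units.mul_right_inj t).1 ((Units.mul_left_inj t).1 this)
  rw [Units.val_mul, Commute, SemiconjBy, mul_assoc, ht', ← mul_assoc z, hs, ← mul_assoc,
    ← mul_assoc, hμs.eq]
  simp only [mul_assoc]

/-- A good subgroup: norms are central on it and nearly so on its double centralizer. -/
structure IsGood (σ : D → D) (X : Subgroup Dˣ) : Prop where
  subnormal : ∃ d, SubnormalOfDepth d X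
  nonAbelian : X.NonAbelian
  norm : NormCentral σ X
  dbl : ∀ w ∈ dblCen X, σ w * w ∈ cen X

omit hσ in
theorem Subgroup.NonAbelian.iterDerived {d : ℕ} {H : Subgroup Dˣ} (hH : SubnormalOfDepth d H)
    (hna : H.NonAbelian) (n : ℕ) : (H.iterDerived n).NonAbelian := by
  induction n with
  | zero => exact hna
  | succ n ih => exact ih.commutator (hH.iterDerived n)

theorem exists_isGood {d : ℕ} {G : Subgroup Dˣ} (hG : SubnormalOfDepth d G)
    (hna : G.NonAbelian) (hn : NormCentral σ G) : ∃ j, IsGood σ (G.iterDerived j) := by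
  have key : ∀ e (K : Subgroup Dˣ), SubnormalOfDepth e K → G ≤ K →
      (∃ j, ∀ w ∈ K, (w : D) ∈ dblCen (G.iterDerived j) → σ w * w ∈ cen (G.iterDerived j)) →
      ∃ j, ∀ w : Dˣ, (w : D) ∈ dblCen (G.iterDerived j) → σ w * w ∈ cen (G.iterDerived j) := by
    intro e
    induction e with
    | zero =>
      intro K hK _ h
      have : K = ⊤ := hK
      subst this
      simpa using h
    | succ e ih =>
      rintro K ⟨K', hK', hle, hnK⟩ hGK ⟨j, hj⟩
      refine ih K' hK' (hGK.trans hle) ⟨j + 1, ?_⟩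
      exact norm_mem_cen_step hσ (fun x hx => hn x (G.iterDerived_le j hx))
        ((G.iterDerived_le j).trans hGK) hnK hj
  obtain ⟨j, hj⟩ := key d G hG le_rfl ⟨0, fun w hw _ => by
    refine mem_cen.2 fun x hx => ?_
    have h1 : ∀ y, Commute (w * σ w) y := hn w hw
    have h2 : σ w * w = w * σ w := by
      have := (h1 w).eq
      rw [mul_assoc] at this
      exact (Units.mul_right_inj w).1 this
    rw [h2]
    exact (h1 x).symm⟩
  refine ⟨j, ⟨_, hG.iterDerived j⟩, hna.iterDerived hG j,
    fun x hx => hn x (G.iterDerived_le j hx), fun w hw => ?_⟩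
  by_cases h0 : w = 0
  · subst h0
    simp
  · exact hj (Units.mk0 w h0) hw

end DivisionCentralizers

section DivisionQuadratic

variable {D : Type*} [DivisionRing D] {σ : D → D}

/-- A division subring, stable under `σ`, with traces `q + σ q` in its center. -/
structure IsQuadratic (σ : D → D) (Q : Subring D) : Prop where
  inv_mem : ∀ q ∈ Q, q⁻¹ ∈ Q
  map_mem : ∀ q ∈ Q, σ q ∈ Q
  trace : ∀ q ∈ Q, ∀ r ∈ Q, Commute (q + σ q) r

theorem IsGood.isQuadratic (hσ : IsFirstKindInvolution σ) {X : Subgroup Dˣ} (hX : IsGood σ X) :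
    IsQuadratic σ (dblCen X) where
  inv_mem _ hq := inv_mem_dblCen hq
  map_mem _ hq := involution_mem_dblCen hσ hX.norm hq
  trace q hq r hr := by
    refine mem_dblCen.1 hr _ ?_
    have h1 := hX.dbl (1 + q) (add_mem (one_mem _) hq)
    have h2 := hX.dbl q hq
    have h3 : q + σ q = σ (1 + q) * (1 + q) - σ q * q - 1 := by
      rw [hσ.add, hσ.map_one]; noncomm_ring
    rw [h3]
    exact sub_mem (sub_mem h1 h2) (one_mem _)

theorem IsQuadratic.trace_mul_commutator (hσ : IsFirstKindInvolution σ) {Q : Subring D}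
    (hQ : IsQuadratic σ Q) {a b y : D} (ha : a ∈ Q) (hb : b ∈ Q) (hy : y ∈ Q) :
    (y + σ y) * (b * a - a * b) =
      b * a * y + b * y * a - (a + σ a) * b * y - a * y * b - y * a * b + (a + σ a) * y * b := by
  have h1 := (hQ.trace (a * σ y) (mul_mem ha (hQ.map_mem y hy)) b hb).eq
  rw [hσ.mul, hσ.invo] at h1
  have h2 := (hQ.trace y hy a ha).eq
  have h3 := (hQ.trace y hy b hb).eq
  have h4 := (hQ.trace a ha b hb).eq
  have h5 := (hQ.trace a ha y hy).eq
  linear_combination (norm := noncomm_ring) -h1 - h2 * b + h3 * a + b * h2 + h4 * y - h5 * b + b * h5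

/-- An element of a quadratic division ring `Q` normalising a noncommutative division subring
lies in that subring up to a central factor. -/
theorem IsQuadratic.exists_central_mul_mem (hσ : IsFirstKindInvolution σ) {Q Q₀ : Subring D}
    (hQ : IsQuadratic σ Q) (hle : Q₀ ≤ Q) (hinv : ∀ q ∈ Q₀, q⁻¹ ∈ Q₀)
    (hmap : ∀ q ∈ Q₀, σ q ∈ Q₀) {a b : D} (ha : a ∈ Q₀) (hb : b ∈ Q₀) (hab : a * b ≠ b * a)
    {x : D} (hx : x ∈ Q) (hx0 : x ≠ 0) (hnorm : ∀ q ∈ Q₀, x * q * x⁻¹ ∈ Q₀) :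
    ∃ e, e ≠ 0 ∧ (∀ q ∈ Q, Commute e q) ∧ x * e ∈ Q₀ := by
  have hu0 : b * a - a * b ≠ 0 := fun h => hab (sub_eq_zero.1 h).symm
  have huQ : b * a - a * b ∈ Q₀ := sub_mem (mul_mem hb ha) (mul_mem ha hb)
  have hxi := hQ.inv_mem x hx
  have hta : a + σ a ∈ Q₀ := add_mem ha (hmap a ha)
  have key : ∀ c ∈ Q₀, x * (x⁻¹ * c + σ (x⁻¹ * c)) ∈ Q₀ := by
    intro c hc
    have h1 := hQ.trace_mul_commutator hσ (hle ha) (hle hb) (mul_mem hxi (hle hc))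
    have h2 : x * (x⁻¹ * c + σ (x⁻¹ * c)) * (b * a - a * b) ∈ Q₀ := by
      rw [mul_assoc, h1]
      have : x * (b * a * (x⁻¹ * c) + b * (x⁻¹ * c) * a - (a + σ a) * b * (x⁻¹ * c) -
          a * (x⁻¹ * c) * b - x⁻¹ * c * a * b + (a + σ a) * (x⁻¹ * c) * b) =
          (x * (b * a) * x⁻¹) * c + (x * b * x⁻¹) * (c * a) -
            (x * ((a + σ a) * b) * x⁻¹) * c - (x * a * x⁻¹) * (c * b) - x * x⁻¹ * (c * a * b) +
            (x * (a + σ a) * x⁻¹) * (c * b) := by noncomm_ring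
      rw [this, mul_inv_cancel₀ hx0, one_mul]
      have hba := hnorm _ (mul_mem hb ha)
      have htb := hnorm _ (mul_mem hta hb)
      exact add_mem (sub_mem (sub_mem (sub_mem (add_mem (mul_mem hba hc)
        (mul_mem (hnorm b hb) (mul_mem hc ha))) (mul_mem htb hc))
        (mul_mem (hnorm a ha) (mul_mem hc hb))) (mul_mem (mul_mem hc ha) hb))
        (mul_mem (hnorm _ hta) (mul_mem hc hb))
    have h3 := mul_mem h2 (hinv _ huQ)
    rwa [mul_inv_cancel_right₀ hu0] at h3
  by_contra! hcon
  have hz : ∀ c ∈ Q₀, x⁻¹ * c + σ (x⁻¹ * c) = 0 := by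
    intro c hc
    by_contra h0
    exact hcon _ h0 (hQ.trace _ (mul_mem hxi (hle hc))) (key c hc)
  set y := x⁻¹
  have hy0 : y ≠ 0 := inv_ne_zero hx0
  have e1 := hz 1 (one_mem _)
  have ea := hz a ha
  have eb := hz b hb
  have eab := hz (a * b) (mul_mem ha hb)
  rw [mul_one] at e1
  rw [hσ.mul] at ea eb eab
  rw [hσ.mul] at eab
  have e1' := eq_neg_of_add_eq_zero_right e1
  rw [e1'] at ea eb eab
  have h : y * (a * b - b * a) = 0 := by
    linear_combination (norm := noncomm_ring) eab - σ b * ea - eb * a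
  rcases mul_eq_zero.1 h with h | h
  · exact hy0 h
  · exact hab (sub_eq_zero.1 h)

theorem cen_le_cen_commutator (hσ : IsFirstKindInvolution σ) {X₁ X₀ Z : Subgroup Dˣ}
    (hX₁ : IsGood σ X₁) (h0 : X₀ ≤ X₁) (hZ : Z ≤ X₁) (hna : X₀.NonAbelian)
    (hn : ∀ h ∈ X₀, ∀ g ∈ Z, g * h * g⁻¹ ∈ X₀) : cen X₀ ≤ cen ⁅Z, Z⁆ := by
  have hQ := hX₁.isQuadratic hσ
  have hN : NormCentral σ X₀ := fun x hx => hX₁.norm x (h0 hx)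
  obtain ⟨a, ha, b, hb, hab⟩ := hna
  have key : ∀ x ∈ Z, ∃ e : D, e ≠ 0 ∧ (∀ q ∈ dblCen X₁, Commute e q) ∧
      (x : D) * e ∈ dblCen X₀ := by
    intro x hx
    refine hQ.exists_central_mul_mem hσ (dblCen_mono h0) (fun q hq => inv_mem_dblCen hq)
      (fun q hq => involution_mem_dblCen hσ hN hq) (val_mem_dblCen ha) (val_mem_dblCen hb)
      (fun h => hab (Units.ext h)) (val_mem_dblCen (hZ hx)) x.ne_zero fun q hq => ?_
    refine mem_dblCen.2 fun r hr => ?_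
    have hr' : (x : D)⁻¹ * r * x ∈ cen X₀ := by
      refine mem_cen.2 fun h hh => ?_
      have h1 := (mem_cen.1 hr _ (hn h hh x hx)).eq
      simp only [Units.val_mul, Units.val_inv_eq_inv_val] at h1
      have h2 : (h : D) * ((x : D)⁻¹ * r * x) = (x : D)⁻¹ * (x * h * (x : D)⁻¹ * r) * x := by
        simp only [mul_assoc, inv_mul_cancel_left₀ x.ne_zero]
      rw [Commute, SemiconjBy, h2, h1]
      simp only [mul_assoc, inv_mul_cancel₀ x.ne_zero, mul_one]
    have h3 := (mem_dblCen.1 hq _ hr').eq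
    have h4 : r * (x * q * (x : D)⁻¹) = x * ((x : D)⁻¹ * r * x * q) * (x : D)⁻¹ := by
      simp only [mul_assoc, mul_inv_cancel_left₀ x.ne_zero]
    rw [Commute, SemiconjBy, h4, h3]
    simp only [mul_assoc, mul_inv_cancel₀ x.ne_zero, mul_one]
  intro z hz
  refine mem_cen_commutator fun x hx y hy => ?_
  obtain ⟨e, he0, he, hk⟩ := key x hx
  obtain ⟨f, hf0, hf, hl⟩ := key y hy
  have hxQ := val_mem_dblCen (hZ hx)
  have hyQ := val_mem_dblCen (hZ hy)
  have h1 : ((x * y * x⁻¹ * y⁻¹ : Dˣ) : D) =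
      (x * e) * (y * f) * ((x : D) * e)⁻¹ * ((y : D) * f)⁻¹ := by
    have hef : Commute e f := by
      have := (he _ (dblCen_mono h0 hl)).eq
      rw [← mul_assoc, (he y hyQ).eq, mul_assoc, mul_assoc] at this
      exact (Units.mul_right_inj y).1 this
    have hxi := (he _ (hQ.inv_mem _ hxQ)).eq
    simp only [Units.val_mul, Units.val_inv_eq_inv_val, mul_inv_rev]
    have hxif := (hf _ (hQ.inv_mem _ hxQ)).eq
    symm
    calc (x : D) * e * (y * f) * (e⁻¹ * (x : D)⁻¹) * (f⁻¹ * (y : D)⁻¹)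
        = x * (e * y) * (f * e⁻¹) * (x : D)⁻¹ * f⁻¹ * (y : D)⁻¹ := by simp only [mul_assoc]
      _ = x * y * (e * (e⁻¹ * f)) * (x : D)⁻¹ * f⁻¹ * (y : D)⁻¹ := by
          rw [(he y hyQ).eq, (hef.symm.inv_right₀).eq]; simp only [mul_assoc]
      _ = x * y * (f * (x : D)⁻¹) * f⁻¹ * (y : D)⁻¹ := by
          rw [mul_inv_cancel_left₀ he0]; simp only [mul_assoc]
      _ = _ := by rw [hxif]; simp only [mul_assoc, mul_inv_cancel_left₀ hf0]
  rw [h1]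
  exact (mem_dblCen.1 (mul_mem (mul_mem (mul_mem hk hl) (inv_mem_dblCen hk))
    (inv_mem_dblCen hl)) z hz).symm

theorem cen_commutator_inf_le (hσ : IsFirstKindInvolution σ) {X₁ : Subgroup Dˣ}
    (hX₁ : IsGood σ X₁) (d : ℕ) (K : Subgroup Dˣ) (hK : SubnormalOfDepth d K)
    (hna : (K ⊓ X₁).NonAbelian) : cen ⁅K ⊓ X₁, K ⊓ X₁⁆ ≤ cen ⁅X₁, X₁⁆ := by
  induction d generalizing K with
  | zero =>
    have : K = ⊤ := hK
    simp [this]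
  | succ d ih =>
    have hK0 := hK
    obtain ⟨K', hK', hle, hn⟩ := hK
    have hle' : K ⊓ X₁ ≤ K' ⊓ X₁ := inf_le_inf_right _ hle
    refine le_trans ?_ (ih K' hK' (hna.mono hle'))
    obtain ⟨e, he⟩ := hX₁.subnormal
    refine cen_le_cen_commutator hσ hX₁ ((commutator_self_le _).trans inf_le_right) inf_le_right
      (hna.commutator (hK0.inf he)) (conj_mem_commutator fun h hh g hg => ?_)
    exact ⟨hn h hh.1 g hg.1, X₁.mul_mem (X₁.mul_mem hg.2 hh.2) (X₁.inv_mem hg.2)⟩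

/-- All non-abelian subnormal subgroups inside `X` have the same centralizer as `X`. -/
def CenStable (X : Subgroup Dˣ) : Prop :=
  ∀ d (Y : Subgroup Dˣ), SubnormalOfDepth d Y → Y ≤ X → Y.NonAbelian → cen Y ≤ cen X

theorem IsGood.cenStable (hσ : IsFirstKindInvolution σ) {X₁ : Subgroup Dˣ}
    (hX₁ : IsGood σ X₁) : CenStable ⁅X₁, X₁⁆ := by
  intro d Y hY hle hna
  have h1 : Y ⊓ X₁ = Y := inf_eq_left.2 (hle.trans (commutator_self_le _))
  have h2 := cen_commutator_inf_le hσ hX₁ d Y hY (by rwa [h1])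
  rw [h1] at h2
  exact (cen_anti (commutator_self_le Y)).trans h2

theorem CenStable.inf_or_centralizes {X : Subgroup Dˣ} {e : ℕ} (hX : SubnormalOfDepth e X)
    (hna : X.NonAbelian) (hst : CenStable X) (d : ℕ) (S : Subgroup Dˣ)
    (hS : SubnormalOfDepth d S) :
    (∃ f Y, SubnormalOfDepth f Y ∧ Y ≤ X ∧ Y ≤ S ∧ Y.NonAbelian) ∨
      ∀ s ∈ S, (s : D) ∈ cen X := by
  induction d generalizing S with
  | zero =>
    have : S = ⊤ := hS
    subst this
    exact Or.inl ⟨e, X, hX, le_rfl, le_top, hna⟩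
  | succ d ih =>
    have hS0 := hS
    obtain ⟨K, hK, hle, hn⟩ := hS
    rcases ih K hK with ⟨f, Y, hY, hYX, hYK, hYna⟩ | h
    swap
    · exact Or.inr fun s hs => h s (hle hs)
    by_cases hYS : (Y ⊓ S).NonAbelian
    · exact Or.inl ⟨_, Y ⊓ S, hY.inf hS0, inf_le_left.trans hYX, inf_le_right, hYS⟩
    right
    have hcen := SubnormalOfDepth.central _ _ (hY.inf hS0) (Subgroup.not_nonAbelian_iff.1 hYS)
    have key : ∀ g (L : Subgroup Dˣ), SubnormalOfDepth g L → Y ≤ L →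
        (∃ k, ⁅Y.iterDerived k, S ⊓ L⁆ = ⊥) → ∃ k, ⁅Y.iterDerived k, S⁆ = ⊥ := by
      intro g
      induction g with
      | zero =>
        intro L hL _ h
        have : L = ⊤ := hL
        simpa [this] using h
      | succ g ihg =>
        rintro L ⟨L', hL', hLL', hnL⟩ hYL ⟨k, hk⟩
        refine ihg L' hL' (hYL.trans hLL') ⟨k + 1, ?_⟩
        have h1 : ⁅Y.iterDerived k, S ⊓ L'⁆ ≤ S ⊓ L := by
          rw [Subgroup.commutator_le]
          intro y hy t ht
          have hy' := Y.iterDerived_le k hy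
          refine ⟨S.mul_mem (hn t ht.1 y (hYK hy')) (S.inv_mem ht.1), ?_⟩
          have h2 : y * t * y⁻¹ * t⁻¹ = y * (t * y⁻¹ * t⁻¹) := by group
          change y * t * y⁻¹ * t⁻¹ ∈ L
          rw [h2]
          exact mul_mem (hYL hy') (hnL _ (inv_mem (hYL hy')) t ht.2)
        have h3 : ⁅⁅Y.iterDerived k, S ⊓ L'⁆, Y.iterDerived k⁆ = ⊥ := by
          rw [eq_bot_iff, ← hk, Subgroup.commutator_comm (Y.iterDerived k) (S ⊓ L)]
          exact Subgroup.commutator_mono h1 le_rfl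
        refine Subgroup.commutator_commutator_eq_bot_of_rotate h3 ?_
        rwa [Subgroup.commutator_comm (S ⊓ L')]
    obtain ⟨k, hk⟩ := key f Y hY le_rfl ⟨0, by
      rw [Subgroup.commutator_eq_bot_iff_le_centralizer]
      intro y _
      rw [Subgroup.mem_centralizer_iff]
      exact fun s hs => hcen s ⟨hs.2, hs.1⟩ y⟩
    intro s hs
    refine hst _ _ (hY.iterDerived k) ((Y.iterDerived_le k).trans hYX)
      (hYna.iterDerived hY k) (mem_cen.2 fun y hy => ?_)
    rw [Subgroup.commutator_eq_bot_iff_le_centralizer] at hk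
    have := Subgroup.mem_centralizer_iff.1 (hk hy) s hs
    exact (congrArg Units.val this).symm

theorem SubnormalOfDepth.conj {d : ℕ} {X : Subgroup Dˣ} (hX : SubnormalOfDepth d X) (w : Dˣ) :
    SubnormalOfDepth d (X.comap (MulAut.conj w).toMonoidHom) := hX.comap _

theorem CenStable.conj_or_centralizes {X : Subgroup Dˣ} {e : ℕ} (hX : SubnormalOfDepth e X)
    (hna : X.NonAbelian) (hst : CenStable X) (w : Dˣ) :
    (∀ r ∈ cen X, w * r * (w : D)⁻¹ ∈ cen X ∧ (w : D)⁻¹ * r * w ∈ cen X) ∨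
      ∀ x ∈ X, w * x * (w : D)⁻¹ ∈ cen X := by
  rcases hst.inf_or_centralizes hX hna e _ (hX.conj w⁻¹) with ⟨f, Y, hY, hYX, hYS, hYna⟩ | h
  · left
    intro r hr
    constructor
    swap
    · have hYw := hY.conj w
      obtain ⟨a, ha, b, hb, hab⟩ := hYna
      refine hst _ _ hYw (fun u hu => by simpa [mul_assoc] using hYS hu)
        ⟨w⁻¹ * a * w, by simpa [mul_assoc] using ha, w⁻¹ * b * w,
          by simpa [mul_assoc] using hb, fun h => hab ?_⟩ (mem_cen.2 fun u hu => ?_)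
      · have h' := congrArg (fun t => w * t * w⁻¹) h
        simpa [mul_assoc] using h'
      · have h1 := (mem_cen.1 hr _ (hYX hu)).eq
        simp only [MulEquiv.toMonoidHom_eq_coe, MonoidHom.coe_coe, MulAut.conj_apply,
          Units.val_mul, Units.val_inv_eq_inv_val] at h1
        have h2 : (u : D) * ((w : D)⁻¹ * r * w) = (w : D)⁻¹ * (w * u * (w : D)⁻¹ * r) * w := by
          simp only [mul_assoc, inv_mul_cancel_left₀ w.ne_zero]
        rw [Commute, SemiconjBy, h2, h1]
        simp only [mul_assoc, inv_mul_cancel₀ w.ne_zero, mul_one]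
    refine hst _ _ hY hYX hYna (mem_cen.2 fun y hy => ?_)
    have h1 := (mem_cen.1 hr _ (show w⁻¹ * y * w ∈ X by simpa using hYS hy)).eq
    simp only [Units.val_mul, Units.val_inv_eq_inv_val] at h1
    have h2 : (y : D) * (w * r * (w : D)⁻¹) = w * ((w : D)⁻¹ * y * w * r) * (w : D)⁻¹ := by
      simp only [mul_assoc, mul_inv_cancel_left₀ w.ne_zero]
    rw [Commute, SemiconjBy, h2, h1]
    simp only [mul_assoc, mul_inv_cancel₀ w.ne_zero, mul_one]
  · right
    intro x hx
    simpa using h (w * x * w⁻¹) (by simpa [Subgroup.mem_comap, mul_assoc] using hx)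

end DivisionQuadratic

section CartanBrauerHua

variable {D : Type*} [DivisionRing D]

theorem not_conj_mem_cen {X : Subgroup Dˣ} {e : ℕ} (hX : SubnormalOfDepth e X)
    (hna : X.NonAbelian) (hst : CenStable X) (w : Dˣ) :
    ¬ ∀ x ∈ X, w * x * (w : D)⁻¹ ∈ cen X := by
  intro hw
  obtain ⟨x₁, hx₁, x₂, hx₂, hne⟩ := hna
  have hne' : (x₁ : D) * x₂ ≠ x₂ * x₁ := fun h => hne (Units.ext h)
  have hw1 : (1 : D) + w ≠ 0 := by
    intro h
    have h1 : (w : D) = -1 := (neg_eq_of_add_eq_zero_right h).symm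
    have h2 := hw x₂ hx₂
    rw [h1] at h2
    norm_num at h2
    exact hne' (mem_cen.1 h2 x₁ hx₁).eq
  set w' := Units.mk0 _ hw1
  set p : Dˣ → D := fun x => w * x * (w : D)⁻¹ with hp
  set p' : Dˣ → D := fun x => (1 + w) * x * (1 + (w : D))⁻¹ with hp'
  have hpw : ∀ x, p x * w = w * x := fun x => by
    simp only [hp, inv_mul_cancel_right₀ w.ne_zero]
  have hpw' : ∀ x, p' x * (1 + w) = (1 + w) * x := fun x => by
    simp only [hp', inv_mul_cancel_right₀ hw1]
  have hdiff : ∀ x, (p' x - p x) * w = x - p' x := fun x => by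
    linear_combination (norm := noncomm_ring) hpw' x - hpw x
  have hpB : ∀ x ∈ X, p x ∈ cen X := hw
  have hδ : ∀ x ∈ X, x ∉ unitsCommuting (x₁ : D) ∨ x ∉ unitsCommuting (x₂ : D) →
      p' x - p x ≠ 0 := by
    intro x hx hx' h0
    have h1 := hdiff x
    rw [h0, zero_mul] at h1
    have h2 : (x : D) = p x := (sub_eq_zero.1 h1.symm).trans (sub_eq_zero.1 h0)
    have h3 := hpB x hx
    rw [← h2] at h3
    rcases hx' with h | h
    · exact h (mem_cen.1 h3 x₁ hx₁).symm
    · exact h (mem_cen.1 h3 x₂ hx₂).symm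
  have hδ₁ := hδ x₁ hx₁ (Or.inr fun h => hne' h)
  have hδ₂ := hδ x₂ hx₂ (Or.inl fun h => hne' (Commute.eq h).symm)
  rcases hst.conj_or_centralizes hX ⟨x₁, hx₁, x₂, hx₂, hne⟩ w' with h | h
  · have hpQ : ∀ x ∈ X, p' x ∈ dblCen X := by
      intro x hx
      refine mem_dblCen.2 fun r hr => ?_
      have h1 := (mem_cen.1 (h r hr).2 x hx).eq
      change (x : D) * ((1 + (w : D))⁻¹ * r * (1 + w)) = (1 + (w : D))⁻¹ * r * (1 + w) * x at h1
      have h2 : r * p' x = (1 + w) * ((1 + (w : D))⁻¹ * r * (1 + w) * x) * (1 + (w : D))⁻¹ := by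
        simp only [hp', mul_assoc, mul_inv_cancel_left₀ hw1]
      rw [Commute, SemiconjBy, h2, ← h1]
      simp only [hp', mul_assoc, mul_inv_cancel₀ hw1, mul_one]
    have hκ : ∀ x ∈ X, p' x - p x ≠ 0 → ∃ κ : D, κ ≠ 0 ∧ κ ∈ dblCen X ∧
        (w : D)⁻¹ = κ * p' x - κ * p x := by
      intro x hx h0
      have h1 : x - p' x ≠ 0 := by
        rw [← hdiff x]
        exact mul_ne_zero h0 w.ne_zero
      refine ⟨(x - p' x)⁻¹, inv_ne_zero h1,
        inv_mem_dblCen (sub_mem (val_mem_dblCen hx) (hpQ x hx)), ?_⟩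
      rw [← mul_sub, ← hdiff x, mul_inv_rev, mul_assoc, inv_mul_cancel₀ h0, mul_one]
    obtain ⟨κ₁, -, hκ₁, hw₁⟩ := hκ x₁ hx₁ hδ₁
    obtain ⟨κ₂, hκ₂0, hκ₂, hw₂⟩ := hκ x₂ hx₂ hδ₂
    have hB := hpB x₁ hx₁
    have c1 : Commute (p x₁) (w : D)⁻¹ := by
      rw [hw₁]
      have c := mem_dblCen.1 hκ₁ _ hB
      exact (c.mul_right (mem_dblCen.1 (hpQ x₁ hx₁) _ hB)).sub_right (c.mul_right (Commute.refl _))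
    have c2 : p x₁ * κ₂ = κ₂ * p x₁ := (mem_dblCen.1 hκ₂ _ hB).eq
    have c3 : p x₁ * p' x₂ = p' x₂ * p x₁ := (mem_dblCen.1 (hpQ x₂ hx₂) _ hB).eq
    have c1' := c1.eq
    rw [hw₂] at c1'
    have h3 : κ₂ * (p x₁ * p x₂ - p x₂ * p x₁) = 0 := by
      linear_combination (norm := noncomm_ring) -c1' + c2 * p' x₂ + κ₂ * c3 - c2 * p x₂
    rcases mul_eq_zero.1 h3 with h3 | h3
    · exact hκ₂0 h3
    · apply hne'
      have h4 : p x₁ * p x₂ * w = w * (x₁ * x₂) := by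
        rw [mul_assoc, hpw, ← mul_assoc, hpw, mul_assoc]
      have h5 : p x₂ * p x₁ * w = w * (x₂ * x₁) := by
        rw [mul_assoc, hpw, ← mul_assoc, hpw, mul_assoc]
      rw [sub_eq_zero.1 h3, h5] at h4
      exact ((Units.mul_right_inj w).1 h4).symm
  · have hβ : ∀ x ∈ X, p' x - p x ≠ 0 → ∃ β γ : D, β ≠ 0 ∧ β ∈ cen X ∧ γ ∈ cen X ∧
        (w : D) = β * x - γ := by
      intro x hx h0
      have h1 : (p' x - p x)⁻¹ ∈ cen X := inv_mem_cen (sub_mem (h x hx) (hpB x hx))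
      refine ⟨_, (p' x - p x)⁻¹ * p' x, inv_ne_zero h0, h1, mul_mem h1 (h x hx), ?_⟩
      rw [← mul_sub, ← hdiff x, inv_mul_cancel_left₀ h0]
    obtain ⟨β₁, γ₁, -, hβ₁, hγ₁, hw₁⟩ := hβ x₁ hx₁ hδ₁
    obtain ⟨β₂, γ₂, hβ0, hβ₂, hγ₂, hw₂⟩ := hβ x₂ hx₂ hδ₂
    have c1 : Commute (x₁ : D) w := by
      rw [hw₁]
      exact ((mem_cen.1 hβ₁ x₁ hx₁).mul_right (Commute.refl _)).sub_right (mem_cen.1 hγ₁ x₁ hx₁)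
    have c2 := (mem_cen.1 hβ₂ x₁ hx₁).eq
    have c3 := (mem_cen.1 hγ₂ x₁ hx₁).eq
    have c1' := c1.eq
    rw [hw₂] at c1'
    have h3 : β₂ * ((x₁ : D) * x₂ - x₂ * x₁) = 0 := by
      linear_combination (norm := noncomm_ring) c1' - c2 * (x₂ : D) + c3
    rcases mul_eq_zero.1 h3 with h3 | h3
    · exact hβ0 h3
    · exact hne' (sub_eq_zero.1 h3)

/-- The Cartan–Brauer–Hua theorem. -/
theorem central_of_conj_mem {B : Subring D} (hinv : ∀ b ∈ B, b⁻¹ ∈ B)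
    (hB : ∀ w : D, w ≠ 0 → ∀ b ∈ B, w * b * w⁻¹ ∈ B) {c : D} (hc : c ∉ B) :
    ∀ b ∈ B, ∀ a : D, Commute a b := by
  have key : ∀ b ∈ B, ∀ a, a ∉ B → Commute a b := by
    intro b hb a ha
    have ha0 : a ≠ 0 := fun h => ha (h ▸ B.zero_mem)
    have ha1 : 1 + a ≠ 0 := by
      intro h
      apply ha
      rw [← neg_eq_of_add_eq_zero_right h]
      exact B.neg_mem B.one_mem
    set b₁ := a * b * a⁻¹ with hb₁
    set b₂ := (1 + a) * b * (1 + a)⁻¹ with hb₂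
    have hb₁B := hB a ha0 b hb
    have hb₂B := hB _ ha1 b hb
    have h1 : b₁ * a = a * b := by rw [hb₁, inv_mul_cancel_right₀ ha0]
    have h2 : b₂ * (1 + a) = (1 + a) * b := by rw [hb₂, inv_mul_cancel_right₀ ha1]
    have h3 : (b₂ - b₁) * a = b - b₂ := by
      linear_combination (norm := noncomm_ring) h2 - h1
    by_cases h0 : b₂ - b₁ = 0
    · rw [h0, zero_mul] at h3
      rw [← sub_eq_zero.1 h0, ← sub_eq_zero.1 h3.symm] at h1
      exact h1.symm
    · refine absurd ?_ ha
      have : a = (b₂ - b₁)⁻¹ * (b - b₂) := by rw [← h3, inv_mul_cancel_left₀ h0]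
      rw [this]
      exact B.mul_mem (hinv _ (B.sub_mem hb₂B hb₁B)) (B.sub_mem hb hb₂B)
  intro b hb a
  by_cases ha : a ∈ B
  · have h1 := key b hb c hc
    have h2 := key b hb (a + c) fun h => hc ((add_sub_cancel_left a c) ▸ B.sub_mem h ha)
    have := h2.sub_left h1
    rwa [add_sub_cancel_right] at this
  · exact key b hb a ha

/-- Central norms on a non-abelian subnormal subgroup of the multiplicative group of a division
ring force all norms to be central. -/
theorem norm_central_of_subnormal {σ : D → D} (hσ : IsFirstKindInvolution σ) {d : ℕ}
    {G : Subgroup Dˣ} (hG : SubnormalOfDepth d G) (hna : G.NonAbelian) (hn : NormCentral σ G)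
    (w y : D) : Commute (σ w * w) y := by
  obtain ⟨j, hj⟩ := exists_isGood hσ hG hna hn
  obtain ⟨e, he⟩ := hj.subnormal
  have hst := hj.cenStable hσ
  set X₁ := G.iterDerived j
  have hX := he.commutator
  have hXna := hj.nonAbelian.commutator he
  obtain ⟨a, ha, b, hb, hab⟩ := id hXna
  have hcen := central_of_conj_mem (B := cen ⁅X₁, X₁⁆) (fun b hb => inv_mem_cen hb)
    (fun w hw r hr => by
      rcases hst.conj_or_centralizes hX hXna (Units.mk0 w hw) with h | h
      · exact (h r hr).1
      · exact absurd h (not_conj_mem_cen hX hXna hst _))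
    (c := b) (fun h => hab (Units.ext (mem_cen.1 h a ha).eq))
  have hcen₁ : ∀ z ∈ cen X₁, ∀ a : D, Commute a z := fun z hz =>
    hcen z (cen_anti (commutator_self_le X₁) hz)
  exact (hcen₁ _ (hj.dbl w (mem_dblCen.2 fun z hz => (hcen₁ z hz w).symm)) y).symm

end CartanBrauerHua

section Transvections

open Matrix MulOpposite

variable {n : Type*} [Fintype n] [DecidableEq n] {D : Type*} [DivisionRing D]

/-- The transvection `1 + v ⊗ f`, where `f` vanishes at `v`. -/
def vecTransvection (v f : n → D) (h : f ⬝ᵥ v = 0) : (Matrix n n D)ˣ where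
  val := 1 + vecMulVec v f
  inv := 1 - vecMulVec v f
  val_inv := by
    have : vecMulVec v f * vecMulVec v f = 0 := by rw [vecMulVec_mul_vecMulVec, h]; simp
    linear_combination (norm := noncomm_ring) -this
  inv_val := by
    have : vecMulVec v f * vecMulVec v f = 0 := by rw [vecMulVec_mul_vecMulVec, h]; simp
    linear_combination (norm := noncomm_ring) -this

@[simp]
theorem val_vecTransvection (v f : n → D) (h : f ⬝ᵥ v = 0) :
    (vecTransvection v f h : Matrix n n D) = 1 + vecMulVec v f := rfl

/-- A subgroup containing all transvections. -/
def ContainsTransvections (H : Subgroup (Matrix n n D)ˣ) : Prop :=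
  ∀ (v f : n → D) (h : f ⬝ᵥ v = 0), vecTransvection v f h ∈ H

theorem exists_dotProduct_eq_zero_ne_zero {p q : n → D} (hp : p ≠ 0)
    (hq : ∀ c : D, q ≠ op c • p) : ∃ f : n → D, f ⬝ᵥ p = 0 ∧ f ⬝ᵥ q ≠ 0 := by
  obtain ⟨i, hi⟩ := Function.ne_iff.1 hp
  obtain ⟨j, hj⟩ := Function.ne_iff.1 (hq ((p i)⁻¹ * q i))
  refine ⟨Pi.single j 1 - Pi.single i (p j * (p i)⁻¹), ?_, ?_⟩
  · rw [sub_dotProduct, single_dotProduct, single_dotProduct, mul_assoc, inv_mul_cancel₀ hi]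
    simp
  · rw [sub_dotProduct, single_dotProduct, single_dotProduct, one_mul, mul_assoc, sub_ne_zero]
    simpa [mul_assoc] using hj

theorem exists_dotProduct_eq_zero_ne_zero_ne_zero {p q r : n → D} (hp : p ≠ 0)
    (hq : ∀ c : D, q ≠ op c • p) (hr : ∀ c : D, r ≠ op c • p) :
    ∃ f : n → D, f ⬝ᵥ p = 0 ∧ f ⬝ᵥ q ≠ 0 ∧ f ⬝ᵥ r ≠ 0 := by
  obtain ⟨f, hf, hfq⟩ := exists_dotProduct_eq_zero_ne_zero hp hq
  obtain ⟨g, hg, hgr⟩ := exists_dotProduct_eq_zero_ne_zero hp hr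
  by_cases h1 : f ⬝ᵥ r = 0
  · by_cases h2 : g ⬝ᵥ q = 0
    · exact ⟨f + g, by simp [hf, hg], by simpa [h2] using hfq, by simpa [h1] using hgr⟩
    · exact ⟨g, hg, h2, hgr⟩
  · exact ⟨f, hf, hfq, h1⟩

theorem exists_mulVec_ne_smul [Nontrivial n] {h y : Matrix n n D} (hy : h * y ≠ y * h) :
    ∃ p : n → D, p ≠ 0 ∧ ∀ c : D, h *ᵥ p ≠ op c • p := by
  by_contra! H
  have H' : ∀ p : n → D, ∃ c : D, h *ᵥ p = op c • p := fun p => by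
    rcases eq_or_ne p 0 with rfl | hp
    · exact ⟨0, by simp⟩
    · exact H p hp
  choose c hc using fun i : n => H' (Pi.single i 1 : n → D)
  have hij : ∀ i j, i ≠ j → ∀ d, c j * d = d * c i := fun i j hne d => by
    obtain ⟨k, hk⟩ := H' (Pi.single i 1 + op d • (Pi.single j 1 : n → D))
    rw [mulVec_add, mulVec_smul, hc, hc] at hk
    have h1 := congrFun hk i
    have h2 := congrFun hk j
    simp [hne, hne.symm] at h1 h2
    rw [h2, h1]
  have hcc : ∀ i d, c i * d = d * c i := fun i d => by
    obtain ⟨j, hj⟩ := exists_ne i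
    have h1 := hij i j hj.symm 1
    rw [mul_one, one_mul] at h1
    rw [← h1, hij i j hj.symm d, h1]
  obtain ⟨i₀⟩ : Nonempty n := inferInstance
  have hs : h = Matrix.scalar n (c i₀) := by
    ext k l
    have hkl := congrFun (hc l) k
    have hcl : c l = c i₀ := by
      rcases eq_or_ne i₀ l with rfl | hne
      · rfl
      · simpa using hij i₀ l hne 1
    rw [mulVec_single_one] at hkl
    rw [scalar_apply, diagonal_apply, ← hcl]
    simpa [Pi.single_apply] using hkl
  exact hy (by rw [hs]; exact (Matrix.scalar_commute _ (fun r => hcc i₀ r) y).eq)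

section Orbits

variable {H K : Subgroup (Matrix n n D)ˣ} (hK : ContainsTransvections K)
  (hn : ∀ h ∈ H, ∀ g ∈ K, g * h * g⁻¹ ∈ H)

include hK hn

theorem exists_mem_mulVec_of_moves {h : (Matrix n n D)ˣ} (hh : h ∈ H) {p : n → D} (hp : p ≠ 0)
    (hm : ∀ c : D, h.val *ᵥ p ≠ op c • p) {v : n → D} (hv : v ≠ 0) :
    ∃ a ∈ H, ∃ c : D, a.val *ᵥ p = op c • v := by
  by_cases hvp : ∃ c : D, v = op c • p
  · obtain ⟨c, rfl⟩ := hvp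
    have hc : c ≠ 0 := by rintro rfl; simp at hv
    exact ⟨1, H.one_mem, c⁻¹, by simp [smul_smul, hc]⟩
  · push Not at hvp
    obtain ⟨f, hfp, hfq, hfv⟩ := exists_dotProduct_eq_zero_ne_zero_ne_zero hp hm hvp
    set q := h.val *ᵥ p
    have hu : (f ⬝ᵥ q)⁻¹ • f ⬝ᵥ (op ((f ⬝ᵥ v)⁻¹ * f ⬝ᵥ q) • v - q) = 0 := by
      rw [smul_dotProduct, dotProduct_sub, dotProduct_smul]
      simp [hfv]
    set t := vecTransvection _ _ hu
    have ht : t ∈ K := hK _ _ _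
    have htp : t⁻¹.val *ᵥ p = p := by
      change (1 - vecMulVec _ _) *ᵥ p = p
      rw [sub_mulVec, vecMulVec_mulVec, smul_dotProduct, hfp]
      simp
    refine ⟨_, hn h hh t ht, (f ⬝ᵥ v)⁻¹ * f ⬝ᵥ q, ?_⟩
    rw [Units.val_mul, Units.val_mul, ← mulVec_mulVec, htp, ← mulVec_mulVec]
    change (1 + vecMulVec _ _) *ᵥ q = _
    rw [add_mulVec, vecMulVec_mulVec, smul_dotProduct]
    simp [hfq]

theorem exists_mem_mulVec [Nontrivial n] (hc : ∃ h ∈ H, ∃ y : (Matrix n n D)ˣ, h * y ≠ y * h)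
    {v w : n → D} (hv : v ≠ 0) (hw : w ≠ 0) :
    ∃ a ∈ H, ∃ c : D, a.val *ᵥ v = op c • w := by
  obtain ⟨h, hh, y, hy⟩ := hc
  obtain ⟨p, hp, hm⟩ := exists_mulVec_ne_smul (h := h.val) (y := y.val)
    (fun e => hy (Units.ext e))
  obtain ⟨a, ha, c, hac⟩ := exists_mem_mulVec_of_moves hK hn hh hp hm hv
  obtain ⟨b, hb, d, hbd⟩ := exists_mem_mulVec_of_moves hK hn hh hp hm hw
  have h1 : op c • (a⁻¹.val *ᵥ v) = p := by
    rw [← mulVec_smul, ← hac, mulVec_mulVec, Units.inv_mul, one_mulVec]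
  have hc0 : c ≠ 0 := by
    rintro rfl
    exact hp (by simpa using h1.symm)
  have h2 : a⁻¹.val *ᵥ v = op c⁻¹ • p := by
    rw [← h1, smul_smul, ← op_mul, mul_inv_cancel₀ hc0, op_one, one_smul]
  exact ⟨b * a⁻¹, H.mul_mem hb (H.inv_mem ha), d * c⁻¹, by
    rw [Units.val_mul, ← mulVec_mulVec, h2, mulVec_smul, hbd, smul_smul, ← op_mul]⟩

theorem commutator_vecTransvection_mem [Nontrivial n]
    (hc : ∃ h ∈ H, ∃ y : (Matrix n n D)ˣ, h * y ≠ y * h) {v f w g : n → D} (hf : f ⬝ᵥ v = 0)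
    (hg : g ⬝ᵥ w = 0) : vecTransvection v f hf * vecTransvection w g hg *
      (vecTransvection v f hf)⁻¹ * (vecTransvection w g hg)⁻¹ ∈ H := by
  rcases eq_or_ne v 0 with rfl | hv
  · have : vecTransvection 0 f hf = 1 := Units.ext (by simp)
    simp [this, H.one_mem]
  rcases eq_or_ne w 0 with rfl | hw
  · have : vecTransvection 0 g hg = 1 := Units.ext (by simp)
    simp [this, H.one_mem]
  obtain ⟨a, ha, c, hac⟩ := exists_mem_mulVec hK hn hc hw hv
  have h1 : op c • (a⁻¹.val *ᵥ v) = w := by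
    rw [← mulVec_smul, ← hac, mulVec_mulVec, Units.inv_mul, one_mulVec]
  have hc0 : c ≠ 0 := by
    rintro rfl
    exact hw (by simpa using h1.symm)
  have h2 : a⁻¹.val *ᵥ v = op c⁻¹ • w := by
    rw [← h1, smul_smul, ← op_mul, mul_inv_cancel₀ hc0, op_one, one_smul]
  set s := vecTransvection v f hf
  set t := vecTransvection w g hg
  have hfw : (f ᵥ* a.val) ⬝ᵥ w = 0 := by
    rw [← dotProduct_mulVec, hac, dotProduct_smul, hf, smul_zero]
  have hcomm : a⁻¹ * s * a * t = t * (a⁻¹ * s * a) := by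
    have h3 : (↑(a⁻¹ * s * a) : Matrix n n D) = 1 + vecMulVec (op c⁻¹ • w) (f ᵥ* a.val) := by
      rw [Units.val_mul, Units.val_mul, val_vecTransvection, mul_add, mul_one, add_mul,
        Units.inv_mul, mul_vecMulVec, vecMulVec_mul, h2]
    refine Units.ext ?_
    rw [Units.val_mul, Units.val_mul t, h3, val_vecTransvection]
    have h4 : vecMulVec (op c⁻¹ • w) (f ᵥ* a.val) * vecMulVec w g = 0 := by
      rw [vecMulVec_mul_vecMulVec, hfw, zero_smul, vecMulVec_zero]
    have h5 : vecMulVec w g * vecMulVec (op c⁻¹ • w) (f ᵥ* a.val) = 0 := by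
      rw [vecMulVec_mul_vecMulVec, dotProduct_smul, hg, smul_zero, zero_smul, vecMulVec_zero]
    linear_combination (norm := noncomm_ring) h4 - h5
  have hsK : s ∈ K := hK _ _ _
  have htK : t ∈ K := hK _ _ _
  have hb : s * a⁻¹ * s⁻¹ * a ∈ H := H.mul_mem (hn _ (H.inv_mem ha) s hsK) ha
  have hb' : (s * a⁻¹ * s⁻¹ * a)⁻¹ ∈ H := H.inv_mem hb
  have h6 : (a⁻¹ * s * a)⁻¹ * t * (a⁻¹ * s * a) = t := by
    rw [mul_assoc, ← hcomm, inv_mul_cancel_left]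
  have h7 : s * t * s⁻¹ * t⁻¹ =
      s * a⁻¹ * s⁻¹ * a * (t * (s * a⁻¹ * s⁻¹ * a)⁻¹ * t⁻¹) := by
    calc s * t * s⁻¹ * t⁻¹ = s * ((a⁻¹ * s * a)⁻¹ * t * (a⁻¹ * s * a)) * s⁻¹ * t⁻¹ := by rw [h6]
      _ = _ := by group
  rw [h7]
  exact H.mul_mem hb (hn _ hb' t htK)

end Orbits

section Generation

variable {F : Type*} [Field F] [Algebra F D]

/-- The embedding of `M₂(F)` attached to two vectors and a dual pair of functionals. -/
def planeHom (v w f g : n → D) (hfv : f ⬝ᵥ v = 0) (hfw : f ⬝ᵥ w = 1) (hgv : g ⬝ᵥ v = 1)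
    (hgw : g ⬝ᵥ w = 0) : Matrix (Fin 2) (Fin 2) F →* Matrix n n D where
  toFun M := 1 + (M 0 0 - 1) • vecMulVec v g + M 0 1 • vecMulVec v f + M 1 0 • vecMulVec w g +
    (M 1 1 - 1) • vecMulVec w f
  map_one' := by simp
  map_mul' M N := by
    simp only [mul_add, add_mul, mul_one, one_mul, smul_mul_assoc, mul_smul_comm,
      vecMulVec_mul_vecMulVec, hfv, hfw, hgv, hgw, one_smul, zero_smul, vecMulVec_zero, smul_zero,
      Matrix.mul_apply, Fin.sum_univ_two]
    module

theorem ContainsTransvections.of_normal [Nontrivial n] {l : F} (hl : l ≠ 0) (hl2 : l ^ 2 ≠ 1)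
    {H K : Subgroup (Matrix n n D)ˣ} (hK : ContainsTransvections K)
    (hn : ∀ h ∈ H, ∀ g ∈ K, g * h * g⁻¹ ∈ H)
    (hc : ∃ h ∈ H, ∃ y : (Matrix n n D)ˣ, h * y ≠ y * h) : ContainsTransvections H := by
  intro v f hfv
  rcases eq_or_ne v 0 with rfl | hv
  · have : vecTransvection 0 f hfv = 1 := Units.ext (by simp)
    simp [this, H.one_mem]
  rcases eq_or_ne f 0 with rfl | hf
  · have : vecTransvection v 0 hfv = 1 := Units.ext (by simp)
    simp [this, H.one_mem]
  obtain ⟨i, hi⟩ := Function.ne_iff.1 hf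
  set w : n → D := Pi.single i (f i)⁻¹ with hw
  have hfw : f ⬝ᵥ w = 1 := by
    rw [hw, dotProduct_single, mul_inv_cancel₀ hi]
  have hw0 : w ≠ 0 := by
    intro h
    simp [h] at hfw
  obtain ⟨g, hgw, hgv⟩ := exists_dotProduct_eq_zero_ne_zero (p := w) (q := v) hw0 (by
    rintro c rfl
    rw [dotProduct_smul, hfw] at hfv
    have : c = 0 := by simpa using hfv
    simp [this] at hv)
  set g' := (g ⬝ᵥ v)⁻¹ • g with hg'
  have hgw' : g' ⬝ᵥ w = 0 := by rw [hg', smul_dotProduct, hgw, smul_zero]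
  have hgv' : g' ⬝ᵥ v = 1 := by rw [hg', smul_dotProduct, smul_eq_mul, inv_mul_cancel₀ hgv]
  set φ := Units.map (planeHom (F := F) v w f g' hfv hfw hgv' hgw')
  let X : F → (Matrix (Fin 2) (Fin 2) F)ˣ := fun a =>
    ⟨!![1, a; 0, 1], !![1, -a; 0, 1], by simp [Matrix.one_fin_two], by simp [Matrix.one_fin_two]⟩
  let Y : F → (Matrix (Fin 2) (Fin 2) F)ˣ := fun a =>
    ⟨!![1, 0; a, 1], !![1, 0; -a, 1], by simp [Matrix.one_fin_two], by simp [Matrix.one_fin_two]⟩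
  have hX : ∀ a, ∃ h, φ (X a) = vecTransvection v (a • f) h := fun a =>
    ⟨by simp [hfv], Units.ext (by simp [φ, X, planeHom])⟩
  have hY : ∀ a, ∃ h, φ (Y a) = vecTransvection w (a • g') h := fun a =>
    ⟨by simp [hgw'], Units.ext (by simp [φ, Y, planeHom])⟩
  let S : Set (Matrix n n D)ˣ := {k | k ∈ K ∧ ∀ (u e : n → D) (h : e ⬝ᵥ u = 0),
    k * vecTransvection u e h * k⁻¹ * (vecTransvection u e h)⁻¹ ∈ H}
  have hSm : ∀ {a b}, a ∈ S → b ∈ S → a * b ∈ S := by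
    rintro a b ⟨ha, ha'⟩ ⟨hb, hb'⟩
    refine ⟨K.mul_mem ha hb, fun u e h => ?_⟩
    have := H.mul_mem (hn _ (hb' u e h) a ha) (ha' u e h)
    convert this using 1
    group
  have hSX : ∀ a, φ (X a) ∈ S := fun a => by
    obtain ⟨h, e⟩ := hX a
    rw [e]
    exact ⟨hK _ _ _, fun u e h' => commutator_vecTransvection_mem hK hn hc h h'⟩
  have hSY : ∀ a, φ (Y a) ∈ S := fun a => by
    obtain ⟨h, e⟩ := hY a
    rw [e]
    exact ⟨hK _ _ _, fun u e h' => commutator_vecTransvection_mem hK hn hc h h'⟩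
  set d := X l * Y (-l⁻¹) * X l * (X (-1) * Y 1 * X (-1)) with hd
  have hdS : φ d ∈ S := by
    simp only [hd, map_mul]
    exact hSm (hSm (hSm (hSX _) (hSY _)) (hSX _)) (hSm (hSm (hSX _) (hSY _)) (hSX _))
  have hl3 : l ^ 2 - 1 ≠ 0 := sub_ne_zero.2 hl2
  have key : d * X (l ^ 2 - 1)⁻¹ * d⁻¹ * (X (l ^ 2 - 1)⁻¹)⁻¹ = X 1 := by
    have hdv : d.val = !![l, 0; 0, l⁻¹] := by
      simp only [hd, X, Y, Units.val_mul, Matrix.mul_fin_two]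
      simp [hl]
    rw [mul_inv_eq_iff_eq_mul, mul_inv_eq_iff_eq_mul]
    refine Units.ext ?_
    simp only [X, Units.val_mul, hdv, Matrix.mul_fin_two]
    ext i j
    fin_cases i <;> fin_cases j <;> simp
    field_simp
    ring
  obtain ⟨h1, e1⟩ := hX (l ^ 2 - 1)⁻¹
  obtain ⟨h2, e2⟩ := hX 1
  have := hdS.2 v _ h1
  rw [← e1, ← map_inv, ← map_inv, ← map_mul, ← map_mul, ← map_mul, key, e2] at this
  simpa using this

/-- A non-abelian subnormal subgroup of a general linear group contains all transvections. -/
theorem SubnormalOfDepth.containsTransvections [Nontrivial n] {l : F} (hl : l ≠ 0)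
    (hl2 : l ^ 2 ≠ 1) {d : ℕ} {H : Subgroup (Matrix n n D)ˣ} (hH : SubnormalOfDepth d H)
    (hc : H.NonAbelian) : ContainsTransvections H := by
  induction d generalizing H with
  | zero =>
    have : H = ⊤ := hH
    subst this
    exact fun _ _ _ => Subgroup.mem_top _
  | succ d ih =>
    obtain ⟨K, hK, hle, hn⟩ := hH
    obtain ⟨a, ha, b, -, hab⟩ := id hc
    exact (ih hK (hc.mono hle)).of_normal hl hl2 hn ⟨a, ha, b, hab⟩

end Generation

end Transvections

theorem exists_notMem_of_card_lt {F : Type*} {k : ℕ} (hF : (k : Cardinal) ≤ Cardinal.mk F)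
    (s : Finset F) (hs : s.card < k) : ∃ x, x ∉ s := by
  by_contra! h
  have h1 : Cardinal.mk F ≤ Cardinal.mk s :=
    Cardinal.mk_le_of_injective (f := fun x => (⟨x, h x⟩ : s)) fun x y hxy => by simpa using hxy
  rw [Cardinal.mk_coe_finset] at h1
  exact absurd (Nat.cast_le.1 (hF.trans h1)) (not_le.2 hs)

section CentralField

variable {F A : Type*} [Field F] [Ring A] [Algebra F A]

theorem commute_of_mem_bot {x : A} (hx : x ∈ (⊥ : Subalgebra F A)) (y : A) : Commute x y := by
  obtain ⟨c, rfl⟩ := Algebra.mem_bot.1 hx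
  exact Algebra.commutes c y

theorem mem_bot_of_commute (hcenter : Subalgebra.center F A = ⊥) {x : A}
    (hx : ∀ y, Commute x y) : x ∈ (⊥ : Subalgebra F A) := by
  rw [← hcenter, Subalgebra.mem_center_iff]
  exact fun y => (hx y).symm

theorem eq_zero_of_mem_bot_of_mul_eq_zero {c x : A} (hc : c ∈ (⊥ : Subalgebra F A)) (hx : x ≠ 0)
    (h : c * x = 0) : c = 0 := by
  obtain ⟨l, rfl⟩ := Algebra.mem_bot.1 hc
  by_contra hne
  have hl : l ≠ 0 := by
    rintro rfl
    simp at hne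
  rw [← Algebra.smul_def] at h
  exact hx ((smul_eq_zero_iff_right hl).1 h)

theorem inv_mem_bot {c : A} (hc : c ∈ (⊥ : Subalgebra F A)) (h0 : c ≠ 0) :
    ∃ d ∈ (⊥ : Subalgebra F A), d * c = 1 := by
  obtain ⟨l, rfl⟩ := Algebra.mem_bot.1 hc
  have hl : l ≠ 0 := by
    rintro rfl
    simp at h0
  exact ⟨algebraMap F A l⁻¹, Subalgebra.algebraMap_mem _ _, by
    rw [← map_mul, inv_mul_cancel₀ hl, map_one]⟩

namespace IsFirstKindInvolution

variable {σ : A → A} (hσ : IsFirstKindInvolution σ)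

include hσ

theorem map_algebraMap (c : F) : σ (algebraMap F A c) = algebraMap F A c :=
  hσ.fix _ (Subring.mem_center_iff.2 fun y => (Algebra.commutes c y).symm)

theorem map_smul (c : F) (x : A) : σ (c • x) = c • σ x := by
  rw [Algebra.smul_def, hσ.mul, hσ.map_algebraMap, Algebra.smul_def, Algebra.commutes]

theorem trace_norm_mem_bot {l m : F} (hl : l ≠ 0) (hm : m ≠ 0) (hlm : l ≠ m) {x : A}
    (h1 : σ (1 + l • x) * (1 + l • x) ∈ (⊥ : Subalgebra F A))
    (h2 : σ (1 + m • x) * (1 + m • x) ∈ (⊥ : Subalgebra F A)) :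
    x + σ x ∈ (⊥ : Subalgebra F A) ∧ σ x * x ∈ (⊥ : Subalgebra F A) := by
  have key : ∀ l : F, l ≠ 0 → σ (1 + l • x) * (1 + l • x) ∈ (⊥ : Subalgebra F A) →
      x + σ x + l • (σ x * x) ∈ (⊥ : Subalgebra F A) := fun l hl h => by
    have := Subalgebra.smul_mem _ (Subalgebra.sub_mem _ h (Subalgebra.one_mem _)) l⁻¹
    convert this using 1
    rw [hσ.add, hσ.map_one, hσ.map_smul]
    simp only [mul_add, add_mul, mul_one, one_mul, smul_mul_smul_comm, smul_sub, smul_add,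
      smul_smul, inv_mul_cancel₀ hl, inv_mul_cancel_left₀ hl, one_smul]
    abel
  have h3 := key l hl h1
  have h4 := key m hm h2
  have h5 : σ x * x ∈ (⊥ : Subalgebra F A) := by
    have := Subalgebra.smul_mem _ (Subalgebra.sub_mem _ h3 h4) (l - m)⁻¹
    convert this using 1
    rw [add_sub_add_left_eq_sub, ← sub_smul, smul_smul, inv_mul_cancel₀ (sub_ne_zero.2 hlm),
      one_smul]
  refine ⟨?_, h5⟩
  have := Subalgebra.sub_mem _ h3 (Subalgebra.smul_mem _ h5 l)
  rwa [add_sub_cancel_right] at this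

theorem eq_neg_of_sq_eq_zero {x : A} (hx : x * x = 0) (h1 : x + σ x ∈ (⊥ : Subalgebra F A))
    (h2 : σ x * x ∈ (⊥ : Subalgebra F A)) : σ x = -x := by
  rcases eq_or_ne x 0 with rfl | hne
  · rw [hσ.map_zero, neg_zero]
  have h3 := eq_zero_of_mem_bot_of_mul_eq_zero h2 hne (by rw [mul_assoc, hx, mul_zero])
  have h4 := eq_zero_of_mem_bot_of_mul_eq_zero h1 hne (by rw [add_mul, hx, h3, add_zero])
  exact eq_neg_of_add_eq_zero_right h4

end IsFirstKindInvolution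

/-- In a ring which is not a division ring, finitely many elements lie in a subalgebra which is a
matrix algebra of size at least two over a division ring. -/
theorem exists_algHom_matrix.{u, v} {F : Type u} {A : Type v} [Field F] [Ring A] [Algebra F A]
    (hloc : ∀ S : Finset A, ∃ B : Subalgebra F A,
      (S : Set A) ⊆ (B : Set A) ∧ IsSimpleRing B ∧ IsArtinianRing B)
    {x₀ : A} (hx₀ : x₀ ≠ 0) (hu : ¬ IsUnit x₀) (S : Finset A) :
    ∃ (k : ℕ) (_ : Nontrivial (Fin k)) (D : Type v) (_ : DivisionRing D) (_ : Algebra F D)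
      (φ : Matrix (Fin k) (Fin k) D →ₐ[F] A), Function.Injective φ ∧ ∀ x ∈ S, ∃ m, φ m = x := by
  classical
  obtain ⟨B, hSB, hs, ha⟩ := hloc (insert x₀ S)
  obtain ⟨k, hk, D, _, _, ⟨e⟩⟩ := IsSimpleRing.exists_algEquiv_matrix_divisionRing F B
  have hφ : ∀ x ∈ B, ∃ m, (B.val.comp e.symm.toAlgHom) m = x := fun x hx =>
    ⟨e ⟨x, hx⟩, by simp⟩
  have hinj : Function.Injective (B.val.comp e.symm.toAlgHom) :=
    Subtype.val_injective.comp e.symm.injective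
  refine ⟨k, ?_, D, _, _, B.val.comp e.symm.toAlgHom, hinj, fun x hx =>
    hφ x (hSB (by simp [hx]))⟩
  rw [Fin.nontrivial_iff_two_le]
  by_contra hlt
  obtain rfl : k = 1 := by
    have := hk.out
    omega
  obtain ⟨m, hm⟩ := hφ x₀ (hSB (by simp))
  have hm0 : m 0 0 ≠ 0 := by
    intro h
    apply hx₀
    rw [← hm, show m = 0 by ext i j; fin_cases i; fin_cases j; exact h, map_zero]
  refine hu (hm ▸ IsUnit.map _ ⟨⟨m, Matrix.of fun _ _ => (m 0 0)⁻¹, ?_, ?_⟩, rfl⟩)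
  · ext i j
    fin_cases i; fin_cases j
    simp [Matrix.mul_apply, hm0]
  · ext i j
    fin_cases i; fin_cases j
    simp [Matrix.mul_apply, hm0]

theorem exists_unit_of_map_eq {R : Type*} [Ring R] [Algebra F R] {φ : R →ₐ[F] A}
    (hφ : Function.Injective φ) {g : Aˣ} (h1 : ∃ m, φ m = g) (h2 : ∃ m, φ m = g⁻¹.val) :
    ∃ u : Rˣ, Units.map (φ : R →* A) u = g := by
  obtain ⟨m, hm⟩ := h1
  obtain ⟨m', hm'⟩ := h2
  exact ⟨⟨m, m', hφ (by simp [hm, hm']), hφ (by simp [hm, hm'])⟩, Units.ext hm⟩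

section MatrixHom

open Matrix

variable {n : Type*} [Fintype n] [DecidableEq n] {D : Type*} [DivisionRing D] [Algebra F D]
  {φ : Matrix n n D →ₐ[F] A} {σ : A → A}

theorem map_vecMulVec_eq_neg (hσ : IsFirstKindInvolution σ)
    {l m : F} (hl : l ≠ 0) (hm : m ≠ 0) (hlm : l ≠ m) {G : Subgroup Aˣ}
    (hG : ∀ g ∈ G, σ g * g ∈ (⊥ : Subalgebra F A))
    (ht : ContainsTransvections (G.comap (Units.map (φ : Matrix n n D →* A)))) {v f : n → D}
    (h : f ⬝ᵥ v = 0) : σ (φ (vecMulVec v f)) = -φ (vecMulVec v f) := by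
  have key : ∀ c : F, σ (1 + c • φ (vecMulVec v f)) * (1 + c • φ (vecMulVec v f)) ∈
      (⊥ : Subalgebra F A) := fun c => by
    have := hG _ (ht v (c • f) (by rw [smul_dotProduct, h, smul_zero]))
    simpa using this
  obtain ⟨h1, h2⟩ := hσ.trace_norm_mem_bot hl hm hlm (key l) (key m)
  refine hσ.eq_neg_of_sq_eq_zero ?_ h1 h2
  rw [← map_mul, vecMulVec_mul_vecMulVec, h, zero_smul, vecMulVec_zero, map_zero]

omit [Fintype n] in
theorem vecMulVec_single_one (i j : n) (d : D) :
    vecMulVec (Pi.single i d) (Pi.single j 1) = single i j d := by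
  ext a b
  by_cases h1 : i = a <;> by_cases h2 : j = b <;> simp [vecMulVec_apply, h1, h2, eq_comm]

theorem commute_map_of_vecMulVec [Nontrivial n] {z : A}
    (h : ∀ v f : n → D, f ⬝ᵥ v = 0 → Commute z (φ (vecMulVec v f))) (y : Matrix n n D) :
    Commute z (φ y) := by
  have hs : ∀ i j, i ≠ j → ∀ d, Commute z (φ (single i j d)) := fun i j hij d => by
    have := h (Pi.single i d) (Pi.single j 1) (by simp [hij])
    rwa [vecMulVec_single_one] at this
  rw [matrix_eq_sum_single y, map_sum]
  refine Commute.sum_right _ _ _ fun i _ => ?_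
  rw [map_sum]
  refine Commute.sum_right _ _ _ fun j _ => ?_
  rcases eq_or_ne i j with rfl | hij
  · obtain ⟨j, hj⟩ := exists_ne i
    rw [show single i i (y i i) = single i j (y i i) * single j i 1 by simp, map_mul]
    exact (hs i j hj.symm _).mul_right (hs j i hj _)
  · exact hs i j hij _

theorem commute_norm_of_map_eq_neg [Nontrivial n] (hσ : IsFirstKindInvolution σ)
    (h : ∀ v f : n → D, f ⬝ᵥ v = 0 → σ (φ (vecMulVec v f)) = -φ (vecMulVec v f))
    (g : (Matrix n n D)ˣ) (y : Matrix n n D) : Commute (σ (φ g) * φ g) (φ y) := by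
  refine commute_map_of_vecMulVec (fun v f hvf => ?_) y
  have h1 := h (g.val *ᵥ v) (f ᵥ* g⁻¹.val) (by
    rw [← dotProduct_mulVec, mulVec_mulVec, Units.inv_mul, one_mulVec, hvf])
  rw [← vecMulVec_mul, ← mul_vecMulVec] at h1
  set x := vecMulVec v f
  have h2 : g.val * x * g⁻¹.val * g.val = g.val * x := by rw [mul_assoc, Units.inv_mul, mul_one]
  generalize g.val * x * g⁻¹.val = x' at h1 h2
  have h3 := congrArg σ (congrArg φ h2)
  rw [map_mul, map_mul, hσ.mul, hσ.mul, h1, h v f hvf] at h3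
  have h4 := congrArg φ h2
  rw [map_mul, map_mul] at h4
  have : σ (φ g) * φ x' = φ x * σ (φ g) := by simpa using h3
  change σ (φ g) * φ g * φ x = φ x * (σ (φ g) * φ g)
  rw [← mul_assoc, ← this, mul_assoc, ← h4, mul_assoc]

end MatrixHom

end CentralField

section NonDivision

open Matrix

universe u v

variable {F : Type u} {A : Type v} [Field F] [Ring A] [Algebra F A]

theorem map_vecMulVec_trace_mem_bot {n : Type*} [Fintype n] [DecidableEq n] {D : Type*}
    [DivisionRing D] [Algebra F D] {φ : Matrix n n D →ₐ[F] A} {σ : A → A}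
    (hσ : IsFirstKindInvolution σ) (hF : (4 : Cardinal) ≤ Cardinal.mk F)
    (hz : ∀ g : Aˣ, σ g * g ∈ (⊥ : Subalgebra F A)) (v f : n → D) :
    φ (vecMulVec v f) + σ (φ (vecMulVec v f)) ∈ (⊥ : Subalgebra F A) := by
  have hF' : ((4 : ℕ) : Cardinal) ≤ Cardinal.mk F := by exact_mod_cast hF
  set c := f ⬝ᵥ v with hc
  have key : ∀ l : F, 1 + l • c ≠ 0 →
      σ (1 + l • φ (vecMulVec v f)) * (1 + l • φ (vecMulVec v f)) ∈ (⊥ : Subalgebra F A) := by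
    intro l hl
    set s := (1 + l • c)⁻¹
    have h1 : vecMulVec v f * vecMulVec v (s • f) = vecMulVec v ((c * s) • f) := by
      rw [vecMulVec_mul_vecMulVec, smul_smul]
    have h2 : vecMulVec v (s • f) * vecMulVec v f = vecMulVec v ((s * c) • f) := by
      rw [vecMulVec_mul_vecMulVec, smul_dotProduct, smul_eq_mul]
    have h3 : s + l • (c * s) = 1 := by
      have : (1 + l • c) * s = 1 := mul_inv_cancel₀ hl
      rwa [add_mul, one_mul, smul_mul_assoc] at this
    have h4 : s + l • (s * c) = 1 := by
      have : s * (1 + l • c) = 1 := inv_mul_cancel₀ hl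
      rwa [mul_add, mul_one, mul_smul_comm] at this
    have h5 : vecMulVec v (s • f) + l • vecMulVec v ((c * s) • f) = vecMulVec v f := by
      rw [← vecMulVec_smul, ← vecMulVec_add, ← smul_assoc, ← add_smul, h3, one_smul]
    have h6 : vecMulVec v (s • f) + l • vecMulVec v ((s * c) • f) = vecMulVec v f := by
      rw [← vecMulVec_smul, ← vecMulVec_add, ← smul_assoc, ← add_smul, h4, one_smul]
    let u : (Matrix n n D)ˣ := ⟨1 + l • vecMulVec v f, 1 - l • vecMulVec v (s • f), by
      rw [mul_sub, mul_one, add_mul, one_mul, smul_mul_smul_comm, h1, ← smul_smul, ← smul_add, h5,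
        add_sub_cancel_right], by
      rw [mul_add, mul_one, sub_mul, one_mul, smul_mul_smul_comm, h2, ← h6]
      module⟩
    simpa [u] using hz (Units.map (φ : Matrix n n D →* A) u)
  obtain ⟨b, hb⟩ : ∃ b : F, ∀ l : F, l ≠ b → 1 + l • c ≠ 0 := by
    by_cases h : ∃ b : F, 1 + b • c = 0
    · obtain ⟨b, hb⟩ := h
      refine ⟨b, fun l hl h => hl ?_⟩
      have h1 : (l - b) • c = 0 := by
        rw [sub_smul, sub_eq_zero]
        exact add_left_cancel (h.trans hb.symm)
      rcases smul_eq_zero.1 h1 with h2 | h2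
      · exact sub_eq_zero.1 h2
      · simp [h2] at hb
    · push Not at h
      exact ⟨0, fun l _ => h l⟩
  classical
  obtain ⟨l, hl⟩ := exists_notMem_of_card_lt hF' {0, b} (Finset.card_le_two.trans_lt (by norm_num))
  obtain ⟨m, hm⟩ := exists_notMem_of_card_lt hF' {0, b, l}
    (Finset.card_le_three.trans_lt (by norm_num))
  simp only [Finset.mem_insert, Finset.mem_singleton, not_or] at hl hm
  exact (hσ.trace_norm_mem_bot hl.1 hm.1 (Ne.symm hm.2.2) (key l (hb l hl.2))
    (key m (hb m hm.2.1))).1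

theorem trace_mem_bot_of_not_isUnit (hF : (4 : Cardinal) ≤ Cardinal.mk F)
    (hcenter : Subalgebra.center F A = ⊥)
    (hloc : ∀ S : Finset A, ∃ B : Subalgebra F A,
      (S : Set A) ⊆ (B : Set A) ∧ IsSimpleRing B ∧ IsArtinianRing B)
    {x₀ : A} (hx₀ : x₀ ≠ 0) (hu : ¬ IsUnit x₀) {d : ℕ} {G : Subgroup Aˣ}
    (hsub : SubnormalOfDepth d G) (hna : G.NonAbelian) {σ : A → A}
    (hσ : IsFirstKindInvolution σ) (hG : ∀ g ∈ G, σ g * g ∈ (⊥ : Subalgebra F A)) (x : A) :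
    x + σ x ∈ (⊥ : Subalgebra F A) := by
  classical
  have hF' : ((4 : ℕ) : Cardinal) ≤ Cardinal.mk F := by exact_mod_cast hF
  obtain ⟨l, hl⟩ := exists_notMem_of_card_lt hF' {0, 1, -1}
    (Finset.card_le_three.trans_lt (by norm_num))
  simp only [Finset.mem_insert, Finset.mem_singleton, not_or] at hl
  have hl2 : l ^ 2 ≠ 1 := fun h => by
    rcases mul_self_eq_one_iff.1 (sq l ▸ h) with h | h
    exacts [hl.2.1 h, hl.2.2 h]
  obtain ⟨a, ha, b, hb, hab⟩ := id hna
  have hz : ∀ g : Aˣ, σ g * g ∈ (⊥ : Subalgebra F A) := fun g =>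
    mem_bot_of_commute hcenter fun y => by
      obtain ⟨k, _, D, _, _, φ, hφ, hS⟩ := exists_algHom_matrix hloc hx₀ hu
        {a.val, a⁻¹.val, b.val, b⁻¹.val, g.val, g⁻¹.val, y}
      simp only [Finset.mem_insert, Finset.mem_singleton, forall_eq_or_imp, forall_eq] at hS
      obtain ⟨ha1, ha2, hb1, hb2, hg1, hg2, y, rfl⟩ := hS
      obtain ⟨a, rfl⟩ := exists_unit_of_map_eq hφ ha1 ha2
      obtain ⟨b, rfl⟩ := exists_unit_of_map_eq hφ hb1 hb2
      obtain ⟨g, rfl⟩ := exists_unit_of_map_eq hφ hg1 hg2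
      have ht := (hsub.comap (Units.map (φ : Matrix (Fin k) (Fin k) D →* A))).containsTransvections
        hl.1 hl2 ⟨a, ha, b, hb, fun h => hab (by rw [← map_mul, h, map_mul])⟩
      exact commute_norm_of_map_eq_neg hσ
        (fun v f h => map_vecMulVec_eq_neg hσ one_ne_zero hl.1 (Ne.symm hl.2.1) hG ht h) g y
  obtain ⟨k, _, D, _, _, φ, hφ, hS⟩ := exists_algHom_matrix hloc hx₀ hu {x}
  obtain ⟨y, rfl⟩ := hS x (by simp)
  clear hS
  induction y using Matrix.induction_on' with
  | h_zero => simp [hσ.map_zero]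
  | h_add p q hp hq =>
    rw [map_add, hσ.add, add_add_add_comm]
    exact Subalgebra.add_mem _ (hp) (hq)
  | h_std_basis i j c =>
    have := map_vecMulVec_trace_mem_bot (φ := φ) hσ hF hz (Pi.single i c) (Pi.single j 1)
    rwa [vecMulVec_single_one] at this

end NonDivision

section TraceNorm

theorem commute_mul_sub_self {A : Type*} [Ring A] {x y s r : A} (hs : ∀ z, Commute s z)
    (hr : ∀ z, Commute r z) (h : Commute (x * y + y * x - r * x - s * y) x) :
    Commute (x * (s - x)) y := by
  change x * (s - x) * y = y * (x * (s - x))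
  linear_combination (norm := noncomm_ring) h.eq + (hs (y * x)).eq + (hr x).eq * x

variable {F A : Type*} [Field F] [Ring A] [Algebra F A] {σ : A → A}

theorem norm_mem_bot_of_trace (hcenter : Subalgebra.center F A = ⊥)
    (hσ : IsFirstKindInvolution σ) (h : ∀ x, x + σ x ∈ (⊥ : Subalgebra F A)) (x : A) :
    x * σ x ∈ (⊥ : Subalgebra F A) := by
  refine mem_bot_of_commute hcenter fun y => ?_
  have h1 := commute_of_mem_bot (h x)
  have h2 := commute_of_mem_bot (h y)
  have h3 := commute_of_mem_bot (h (x * σ y))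
  rw [hσ.mul, hσ.invo] at h3
  have := commute_mul_sub_self (x := x) (y := y) h1 h2 (by
    have := (h3 x).neg_left
    have e1 := (h2 x).eq
    have e2 := (h1 y).eq
    convert this using 1
    linear_combination (norm := noncomm_ring) -e1 - e2)
  rwa [add_sub_cancel_left] at this

theorem trace_mem_bot_of_norm (hσ : IsFirstKindInvolution σ)
    (h : ∀ x, x * σ x ∈ (⊥ : Subalgebra F A)) (x : A) : x + σ x ∈ (⊥ : Subalgebra F A) := by
  have h1 := Subalgebra.sub_mem _ (Subalgebra.sub_mem _ (h (1 + x)) (h x)) (Subalgebra.one_mem _)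
  rw [hσ.add, hσ.map_one] at h1
  convert h1 using 1
  noncomm_ring

theorem norm_mem_bot_of_trace_subgroup (hσ : IsFirstKindInvolution σ) {G : Subgroup Aˣ}
    (hna : G.NonAbelian) (h : ∀ g ∈ G, (g : A) + σ g ∈ (⊥ : Subalgebra F A)) {g : Aˣ} (hg : g ∈ G) :
    (g : A) * σ g ∈ (⊥ : Subalgebra F A) := by
  have hs := commute_of_mem_bot (h g hg)
  have hcomm : ∀ k ∈ G, Commute ((g : A) * σ g) k := fun k hk => by
    have hr := commute_of_mem_bot (h k hk)
    have ht := commute_of_mem_bot (h (g * k) (G.mul_mem hg hk))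
    have hc := commute_of_mem_bot (Subalgebra.mul_mem _ (h k hk) (h g hg))
    have := commute_mul_sub_self (x := (g : A)) (y := k) hs hr (by
      have := (ht g).sub_left (hc g)
      have e1 := (hr g).eq
      have e2 := (hs k).eq
      convert this using 1
      rw [Units.val_mul, hσ.mul]
      linear_combination (norm := noncomm_ring) -e2)
    rwa [add_sub_cancel_left] at this
  by_cases hr : ∃ k ∈ G, (k : A) + σ k ≠ 0
  · obtain ⟨k, hk, hk0⟩ := hr
    obtain ⟨d, hd, hdk⟩ := inv_mem_bot (h k hk) hk0
    have h1 := Subalgebra.mul_mem _ (h g hg) (h (g * k) (G.mul_mem hg hk))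
    have h2 := h (g * (g * k)) (G.mul_mem hg (G.mul_mem hg hk))
    have h3 := Subalgebra.mul_mem _ (Subalgebra.sub_mem _ h1 h2) hd
    have hr := commute_of_mem_bot (h k hk)
    have e : ((g : A) + σ g) * (((g * k : Aˣ) : A) + σ (g * k : Aˣ)) -
        (((g * (g * k) : Aˣ) : A) + σ (g * (g * k) : Aˣ)) = g * σ g * (k + σ k) := by
      simp only [Units.val_mul, hσ.mul]
      linear_combination (norm := noncomm_ring) (hs (σ k * σ g)).eq + (hs g).eq * k +
        σ k * (hs g).eq + (hr (g * σ g)).eq + (hcomm k hk).eq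
    rwa [e, mul_assoc, (hr d).eq, hdk, mul_one] at h3
  · push Not at hr
    exfalso
    obtain ⟨a, ha, b, hb, hab⟩ := hna
    have hneg : ∀ k ∈ G, σ k = -k := fun k hk => eq_neg_of_add_eq_zero_right (hr k hk)
    have h1 : ∀ k ∈ G, ∀ l ∈ G, (k * l : A) = -(l * k) := fun k hk l hl => by
      have := hneg (k * l) (G.mul_mem hk hl)
      rw [Units.val_mul, hσ.mul, hneg k hk, hneg l hl, neg_mul_neg] at this
      rw [this, neg_neg]
    have h2 := h1 1 G.one_mem 1 G.one_mem
    have h3 := h1 a ha b hb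
    apply hab
    refine Units.ext ?_
    rw [Units.val_mul, h3, Units.val_mul, neg_eq_neg_one_mul]
    simp only [Units.val_one, mul_one] at h2
    rw [← h2, one_mul]

theorem norm_comm_mem_bot {g : Aˣ} {t : A} (h : (g : A) * t ∈ (⊥ : Subalgebra F A)) :
    t * g ∈ (⊥ : Subalgebra F A) := by
  have h1 := (commute_of_mem_bot h (g⁻¹ : Aˣ)).eq
  rw [← mul_assoc, Units.inv_mul, one_mul] at h1
  rwa [(Units.mul_inv_eq_iff_eq_mul g).1 h1] at h

theorem norm_mem_bot_of_division {A : Type*} [Ring A] [Algebra F A] [Nontrivial A] {σ : A → A}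
    (hcenter : Subalgebra.center F A = ⊥)
    (hdiv : ∀ x : A, x ≠ 0 → IsUnit x) {d : ℕ} {G : Subgroup Aˣ} (hsub : SubnormalOfDepth d G)
    (hna : G.NonAbelian) (hσ : IsFirstKindInvolution σ)
    (hG : ∀ g ∈ G, (g : A) * σ g ∈ (⊥ : Subalgebra F A)) (x : A) :
    x * σ x ∈ (⊥ : Subalgebra F A) := by
  let _ : DivisionRing A := DivisionRing.ofIsUnitOrEqZero fun a => by
    by_cases h : a = 0
    · exact Or.inr h
    · exact Or.inl (hdiv a h)
  refine mem_bot_of_commute hcenter fun y => ?_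
  have := norm_central_of_subnormal hσ hsub hna (fun g hg y => commute_of_mem_bot (hG g hg) y)
    (σ x) y
  rwa [hσ.invo] at this

theorem finrank_eq_four (hdiv : ∀ x : A, x ≠ 0 → IsUnit x) (hσ : IsFirstKindInvolution σ)
    (h : ∀ x, x + σ x ∈ (⊥ : Subalgebra F A)) {a b : A} (hab : a * b ≠ b * a) :
    Module.finrank F A = 4 := by
  have : Nontrivial A := ⟨_, _, hab⟩
  have hinj := FaithfulSMul.algebraMap_injective F A
  choose τ hτ using fun x => Algebra.mem_bot.1 (h x)
  let T : A →ₗ[F] F :=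
    { toFun := τ
      map_add' := fun x y => hinj (by rw [map_add, hτ, hτ, hτ, hσ.add]; abel)
      map_smul' := fun c x => hinj (by
        rw [RingHom.id_apply, smul_eq_mul, map_mul, hτ, hτ, hσ.map_smul, ← smul_add,
          Algebra.smul_def]) }
  have hT : ∀ x, T x = 0 → x + σ x = 0 := fun x hx => by
    rw [← hτ, show τ x = 0 from hx, map_zero]
  let Φ : A →ₗ[F] (Fin 4 → F) := LinearMap.pi fun i =>
    T ∘ₗ LinearMap.mulRight F (![1, σ a, σ b, σ (a * b)] i)
  have hΦ : Function.Injective Φ := by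
    rw [← LinearMap.ker_eq_bot, LinearMap.ker_eq_bot']
    intro x hx
    have h0 := hT _ (congrFun hx 0)
    have h1 := hT _ (congrFun hx 1)
    have h2 := hT _ (congrFun hx 2)
    have h3 := hT _ (congrFun hx 3)
    simp [hσ.mul, hσ.invo] at h0 h1 h2 h3
    have hx' : σ x = -x := eq_neg_of_add_eq_zero_right h0
    rw [hx'] at h1 h2 h3
    by_contra hx0
    obtain ⟨u, hu⟩ := hdiv x hx0
    apply hab
    rw [← u.mul_left_inj, hu]
    linear_combination (norm := noncomm_ring) -h3 + h2 * σ a + b * h1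
  have hfin : Module.Finite F A := Module.Finite.of_injective Φ hΦ
  have hunit : ∀ x y : A, x * y = 0 → y ≠ 0 → x = 0 := fun x y hxy hy =>
    (hdiv y hy).mul_left_eq_zero.1 hxy
  have hlin : ∀ α β : F, algebraMap F A α + β • a = 0 → α = 0 ∧ β = 0 := fun α β hαβ => by
    have hβ : β = 0 := by
      by_contra hβ
      have : a = algebraMap F A (-β⁻¹ * α) := by
        have := congrArg (β⁻¹ • ·) hαβ
        simp only [smul_add, smul_smul, inv_mul_cancel₀ hβ, one_smul, smul_zero] at this
        rw [map_mul, map_neg, neg_mul, ← Algebra.smul_def]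
        exact eq_neg_of_add_eq_zero_right this
      exact hab (by rw [this]; exact Algebra.commutes _ b)
    rw [hβ, zero_smul, add_zero] at hαβ
    exact ⟨hinj (by rw [hαβ, map_zero]), hβ⟩
  have hli : LinearIndependent F ![1, a, b, a * b] := by
    rw [Fintype.linearIndependent_iff]
    intro c hc
    simp only [Fin.sum_univ_four] at hc
    simp at hc
    have h1 : (algebraMap F A (c 2) + c 3 • a) * (a * b - b * a) = 0 := by
      have e1 := congrArg (a * ·) hc
      have e2 := congrArg (· * a) hc
      simp only [mul_add, add_mul, mul_smul_comm, smul_mul_assoc, mul_zero, zero_mul, mul_one,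
        one_mul] at e1 e2
      rw [add_mul, ← Algebra.smul_def, smul_mul_assoc, mul_sub, smul_sub, smul_sub]
      have := congrArg₂ (· - ·) e1 e2
      simp only [mul_assoc, sub_zero] at this ⊢
      rw [← this]
      abel
    obtain ⟨h2, h3⟩ := hlin _ _ (hunit _ _ h1 (sub_ne_zero.2 hab))
    rw [h2, h3, zero_smul, zero_smul, add_zero, add_zero, ← Algebra.algebraMap_eq_smul_one] at hc
    obtain ⟨h0, h1⟩ := hlin _ _ hc
    intro i
    fin_cases i <;> assumption
  apply le_antisymm
  · simpa using LinearMap.finrank_le_finrank_of_injective hΦ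
  · simpa using hli.fintype_card_le_finrank

theorem exists_algEquiv_matrix_adjugate (hσ : IsFirstKindInvolution σ)
    (h : ∀ x, x + σ x ∈ (⊥ : Subalgebra F A)) {p q : A} (hp : p * p = 0) (hq : q * q = 0)
    (hpq : p * q + q * p = 1) (hσp : σ p = -p) (hσq : σ q = -q) [Nontrivial A] :
    ∃ e : A ≃ₐ[F] Matrix (Fin 2) (Fin 2) F,
      ∀ x : A, e (σ x) = Matrix.adjugate (e x) := by
  have hpqp : p * (q * p) = p := by
    linear_combination (norm := noncomm_ring) p * hpq - hp * q
  have hqpq : q * (p * q) = q := by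
    linear_combination (norm := noncomm_ring) q * hpq - hq * p
  have hqqp : q * (q * p) = 0 := by rw [← mul_assoc, hq, zero_mul]
  have hppq : p * (p * q) = 0 := by rw [← mul_assoc, hp, zero_mul]
  let ψ : Matrix (Fin 2) (Fin 2) F →ₐ[F] A := AlgHom.ofLinearMap
    { toFun := fun M => M 0 0 • (p * q) + M 0 1 • p + M 1 0 • q + M 1 1 • (q * p)
      map_add' := fun M N => by simp only [Matrix.add_apply]; module
      map_smul' := fun c M => by
        simp only [Matrix.smul_apply, RingHom.id_apply, smul_eq_mul]; module }
    (by simp [hpq])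
    (fun M N => by
      simp only [LinearMap.coe_mk, AddHom.coe_mk, mul_add, add_mul, smul_mul_assoc,
        mul_smul_comm, mul_assoc, hp, hq, hpqp, hqpq, hqqp, hppq, smul_zero, mul_zero,
        Matrix.mul_apply, Fin.sum_univ_two]
      module)
  have hψ : ∀ M, ψ M = M 0 0 • (p * q) + M 0 1 • p + M 1 0 • q + M 1 1 • (q * p) := fun M => rfl
  have hσpq : σ (p * q) = q * p := by rw [hσ.mul, hσp, hσq, neg_mul_neg]
  have hσqp : σ (q * p) = p * q := by rw [hσ.mul, hσp, hσq, neg_mul_neg]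
  have hcorner : ∀ x, ∃ c : F, p * q * x * (p * q) = c • (p * q) := fun x => by
    obtain ⟨c, hc⟩ := Algebra.mem_bot.1 (h (p * q * x * (p * q)))
    refine ⟨c, ?_⟩
    rw [hσ.mul (p * q * x), hσpq] at hc
    rw [Algebra.smul_def, Algebra.commutes, hc]
    linear_combination (norm := noncomm_ring)
      -(p * hqpq * x * p * q) - p * hq * p * σ (p * q * x)
  have hsurj : Function.Surjective ψ := fun x => by
    obtain ⟨c00, h00⟩ := hcorner x
    obtain ⟨c01, h01⟩ := hcorner (x * q)
    obtain ⟨c10, h10⟩ := hcorner (p * x)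
    obtain ⟨c11, h11⟩ := hcorner (p * x * q)
    have k01 : c01 • p = p * q * x * (q * p) := by
      have := congrArg (· * p) h01
      simp only [smul_mul_assoc, mul_assoc, hpqp, hqpq] at this ⊢
      exact this.symm
    have k10 : c10 • q = q * p * x * (p * q) := by
      have := congrArg (q * ·) h10
      simp only [mul_smul_comm, ← mul_assoc] at this ⊢
      simp only [mul_assoc q p q, hqpq] at this
      exact this.symm
    have k11 : c11 • (q * p) = q * p * x * (q * p) := by
      have e : q * p * x * (q * p) = q * (p * q * (p * x * q) * (p * q)) * p := by
        linear_combination (norm := noncomm_ring)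
          -(q * hpqp * x * (q * p * q) * p) - q * p * x * hqpq * p
      rw [e, h11, mul_smul_comm, smul_mul_assoc, hqpq]
    refine ⟨!![c00, c01; c10, c11], ?_⟩
    calc ψ !![c00, c01; c10, c11] = c00 • (p * q) + c01 • p + c10 • q + c11 • (q * p) := by
          simp [hψ]
      _ = (p * q + q * p) * x * (p * q + q * p) := by
          rw [← h00, k01, k10, k11]
          noncomm_ring
      _ = x := by rw [hpq, one_mul, mul_one]
  have hinj : Function.Injective ψ := RingHom.injective (ψ : Matrix (Fin 2) (Fin 2) F →+* A)
  let e := AlgEquiv.ofBijective ψ ⟨hinj, hsurj⟩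
  refine ⟨e.symm, fun x => ?_⟩
  obtain ⟨M, rfl⟩ := e.surjective x
  rw [AlgEquiv.symm_apply_apply, AlgEquiv.symm_apply_eq]
  change σ (ψ M) = ψ _
  rw [hψ, hψ, hσ.add, hσ.add, hσ.add, hσ.map_smul, hσ.map_smul, hσ.map_smul, hσ.map_smul, hσpq,
    hσqp, hσp, hσq, Matrix.adjugate_fin_two]
  simp
  abel

end TraceNorm

/-- A symplectic-type involution on an algebra that is locally a matrix algebra of size at least
two is the adjugate involution on two by two matrices. -/
theorem exists_algEquiv_matrix_of_not_isUnit {F A : Type*} [Field F] [Ring A] [Algebra F A]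
    (hcenter : Subalgebra.center F A = ⊥)
    (hloc : ∀ S : Finset A, ∃ B : Subalgebra F A,
      (S : Set A) ⊆ (B : Set A) ∧ IsSimpleRing B ∧ IsArtinianRing B)
    {x₀ : A} (hx₀ : x₀ ≠ 0) (hu : ¬ IsUnit x₀) {σ : A → A}
    (hσ : IsFirstKindInvolution σ) (h : ∀ x, x + σ x ∈ (⊥ : Subalgebra F A)) :
    ∃ e : A ≃ₐ[F] Matrix (Fin 2) (Fin 2) F,
      ∀ x : A, e (σ x) = Matrix.adjugate (e x) := by
  obtain ⟨k, _, D, _, _, φ, hφ, -⟩ := exists_algHom_matrix hloc hx₀ hu ∅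
  obtain ⟨i, j, hij⟩ := exists_pair_ne (Fin k)
  have hneg : ∀ x : A, x * x = 0 → σ x = -x := fun x hx =>
    hσ.eq_neg_of_sq_eq_zero hx (h x) (by
      have := norm_mem_bot_of_trace hcenter hσ h (σ x)
      rwa [hσ.invo] at this)
  set p := φ (Matrix.single i j 1) with hp_def
  set q := φ (Matrix.single j i 1) with hq_def
  have hp : p * p = 0 := by
    rw [hp_def, ← map_mul, Matrix.single_mul_single_of_ne _ _ _ _ hij.symm, map_zero]
  have hq : q * q = 0 := by
    rw [hq_def, ← map_mul, Matrix.single_mul_single_of_ne _ _ _ _ hij, map_zero]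
  have hpq : p * q = φ (Matrix.single i i 1) := by
    rw [hp_def, hq_def, ← map_mul, Matrix.single_mul_single_same, mul_one]
  have hpq0 : p * q ≠ 0 := by
    rw [hpq, Ne, map_eq_zero_iff φ hφ]
    intro h0
    simpa using congrFun (congrFun h0 i) i
  have hidem : p * q * (p * q) = p * q := by
    rw [hpq, ← map_mul, Matrix.single_mul_single_same, mul_one]
  have hσp := hneg p hp
  have hσq := hneg q hq
  have hsum : p * q + q * p - 1 ∈ (⊥ : Subalgebra F A) := by
    have := Subalgebra.sub_mem _ (h (p * q)) (Subalgebra.one_mem _)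
    rwa [hσ.mul, hσp, hσq, neg_mul_neg] at this
  have hone := eq_zero_of_mem_bot_of_mul_eq_zero hsum hpq0 (by
    linear_combination (norm := noncomm_ring) hidem + q * hp * q)
  have : Nontrivial A := ⟨_, _, hpq0⟩
  exact exists_algEquiv_matrix_adjugate hσ h hp hq (sub_eq_zero.1 hone) hσp hσq

/-- Let `A` be an algebra over a field `F` which is the center of `A`
and has at least four elements, such that every finite subset of `A` is contained
in an `F`-subalgebra that is a simple artinian ring. Let `G` be a non-abelian
subnormal subgroup of `Aˣ` and `σ` an involution of the first kind on `A`. Then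
(1) `g + σ g ∈ F` for all `g ∈ G`, (2) `x + σ x ∈ F` for all `x ∈ A`,
(3) `x * σ x ∈ F` for all `x ∈ A`, (4) `g * σ g ∈ F` for all `g ∈ G` are
equivalent; moreover if one of them holds then either (i) `A` is a quaternion
division algebra over `F` (`dim_F A = 4`) or (ii) there is an `F`-algebra
isomorphism `e : A ≃ M_2(F)` with `e (σ x) = adjugate (e x)` for all `x`. -/
theorem almost_locally_simple_artinian_tfae (F A : Type*) [Field F] [Ring A]
    [Algebra F A]
    (hF : (4 : Cardinal) ≤ Cardinal.mk F)
    (hcenter : Subalgebra.center F A = ⊥)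
    (hloc : ∀ S : Finset A, ∃ B : Subalgebra F A,
      (S : Set A) ⊆ (B : Set A) ∧ IsSimpleRing B ∧ IsArtinianRing B)
    (G : Subgroup Aˣ) (hsub : G.IsSubnormal')
    (hnab : ¬ ∀ a ∈ G, ∀ b ∈ G, a * b = b * a)
    (σ : A → A)
    (hadd : ∀ x y : A, σ (x + y) = σ x + σ y)
    (hmul : ∀ x y : A, σ (x * y) = σ y * σ x)
    (hinvo : ∀ x : A, σ (σ x) = x)
    (hfirst : ∀ x ∈ Subring.center A, σ x = x) :
    ([∀ g ∈ G, (g : A) + σ g ∈ (⊥ : Subalgebra F A),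
      ∀ x : A, x + σ x ∈ (⊥ : Subalgebra F A),
      ∀ x : A, x * σ x ∈ (⊥ : Subalgebra F A),
      ∀ g ∈ G, (g : A) * σ g ∈ (⊥ : Subalgebra F A)].TFAE) ∧
    ((∀ g ∈ G, (g : A) + σ g ∈ (⊥ : Subalgebra F A)) →
      ((∀ x : A, x ≠ 0 → IsUnit x) ∧ Module.finrank F A = 4) ∨
      (∃ e : A ≃ₐ[F] Matrix (Fin 2) (Fin 2) F,
        ∀ x : A, e (σ x) = Matrix.adjugate (e x))) := by
  have hσ : IsFirstKindInvolution σ := ⟨hadd, hmul, hinvo, hfirst⟩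
  obtain ⟨d, hd⟩ := hsub.exists_depth
  have hna : G.NonAbelian := by
    by_contra h
    exact hnab (Subgroup.not_nonAbelian_iff.1 h)
  obtain ⟨a, -, b, -, hab⟩ := id hna
  have hab' : (a * b : A) ≠ b * a := fun h => hab (Units.ext h)
  have : Nontrivial A := ⟨_, _, hab'⟩
  have h14 : (∀ g ∈ G, (g : A) + σ g ∈ (⊥ : Subalgebra F A)) →
      ∀ g ∈ G, (g : A) * σ g ∈ (⊥ : Subalgebra F A) := fun h g hg =>
    norm_mem_bot_of_trace_subgroup hσ hna h hg
  have h42 : (∀ g ∈ G, (g : A) * σ g ∈ (⊥ : Subalgebra F A)) →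
      ∀ x : A, x + σ x ∈ (⊥ : Subalgebra F A) := fun h => by
    by_cases hdiv : ∀ x : A, x ≠ 0 → IsUnit x
    · exact trace_mem_bot_of_norm hσ (norm_mem_bot_of_division hcenter hdiv hd hna hσ h)
    · push Not at hdiv
      obtain ⟨x₀, hx₀, hu⟩ := hdiv
      exact trace_mem_bot_of_not_isUnit hF hcenter hloc hx₀ hu hd hna hσ
        fun g hg => norm_comm_mem_bot (h g hg)
  refine ⟨?_, fun h => ?_⟩
  · tfae_have 1 → 4 := h14
    tfae_have 4 → 2 := h42
    tfae_have 2 → 1 := fun h g _ => h g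
    tfae_have 2 → 3 := norm_mem_bot_of_trace hcenter hσ
    tfae_have 3 → 2 := trace_mem_bot_of_norm hσ
    tfae_finish
  · have h2 := h42 (h14 h)
    by_cases hdiv : ∀ x : A, x ≠ 0 → IsUnit x
    · exact Or.inl ⟨hdiv, finrank_eq_four hdiv hσ h2 hab'⟩
    · push Not at hdiv
      obtain ⟨x₀, hx₀, hu⟩ := hdiv
      exact Or.inr (exists_algEquiv_matrix_of_not_isUnit hcenter hloc hx₀ hu hσ h2)
end

section
/- Let D be a division ring with involution ⋆ of the first kind, and let K be a commutative subfield of D (not necessarily invariant under ⋆). If x + x^⋆ ∈ K and x·x^⋆ ∈ K for every x ∈ D, then D is centrally finite with dimension at most 4 over its center; that is, D is either a field or a quaternion division ring. -/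
section InvolutionTraces

variable {D : Type*} [DivisionRing D] {σ : D → D}

/-- If all traces `x + σ x` and norms `x * σ x` lie in a commutative subfield `K`, then traces
commute with symmetric elements. -/
theorem commute_trace_of_symmetric
    (hadd : ∀ x y : D, σ (x + y) = σ x + σ y)
    (hmul : ∀ x y : D, σ (x * y) = σ y * σ x)
    (hinvo : ∀ x : D, σ (σ x) = x)
    (K : Subfield D) (hK : ∀ a ∈ K, ∀ b ∈ K, a * b = b * a)
    (h : ∀ x : D, x + σ x ∈ K ∧ x * σ x ∈ K)
    {s : D} (hs : σ s = s) (y : D) :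
    s * (y + σ y) = (y + σ y) * s := by
  have ht := (h y).1
  have hσt : σ (y + σ y) = y + σ y := by rw [hadd, hinvo, add_comm]
  have hsts : s * (y + σ y) * s ∈ K := by
    have := (h (s * y * s)).1
    simp only [hmul, hs] at this
    convert this using 1
    noncomm_ring
  have hst := (h (s * (y + σ y))).1
  rw [hmul, hs, hσt] at hst
  generalize y + σ y = t at *
  by_cases h2 : (2 : D) = 0
  · have hss := (h s).2
    rw [hs] at hss
    have hneg : ∀ a : D, a + a = 0 := fun a => by rw [← two_mul, h2, zero_mul]
    have h₁ := hK _ hst _ ht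
    have h₂ := hK _ hsts _ ht
    have h₃ := hK _ hss _ ht
    have hc : (s * t + t * s) * (s * t + t * s) = 0 := by
      have e₁ : s * t * t = t * t * s := by
        have : s * t * t + t * s * t = t * t * s + t * s * t := by
          rw [← add_mul, h₁]; noncomm_ring
        exact add_right_cancel this
      calc (s * t + t * s) * (s * t + t * s)
          = s * t * s * t + (s * t * t) * s + t * (s * s * t) + t * (s * t * s) := by
            noncomm_ring
        _ = t * (s * t * s) + t * t * s * s + t * (t * (s * s)) + t * (s * t * s) := by
            rw [h₂, e₁, h₃]
        _ = (t * (s * t * s) + t * (s * t * s)) + (t * t * s * s + t * t * s * s) := by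
            noncomm_ring
        _ = 0 := by rw [hneg, hneg, add_zero]
    have hc' := mul_self_eq_zero.mp hc
    exact add_right_cancel (hc'.trans (hneg _).symm)
  · have hsK : s ∈ K := by
      have h₁ := (h s).1
      rw [hs, ← two_mul] at h₁
      have h₂ : (2 : D) ∈ K := by exact_mod_cast natCast_mem K 2
      simpa [h2] using K.mul_mem (K.inv_mem h₂) h₁
    exact hK _ hsK _ ht

/-- If every trace commutes with every symmetric element, then traces are central. -/
theorem trace_mem_center_of_commute_symmetric
    (hadd : ∀ x y : D, σ (x + y) = σ x + σ y)
    (hmul : ∀ x y : D, σ (x * y) = σ y * σ x)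
    (hinvo : ∀ x : D, σ (σ x) = x)
    (hcomm : ∀ s : D, σ s = s → ∀ y : D, s * (y + σ y) = (y + σ y) * s) (y : D) :
    y + σ y ∈ Subring.center D := by
  rw [Subring.mem_center_iff]
  intro x
  have hσt : σ (y + σ y) = y + σ y := by rw [hadd, hinvo, add_comm]
  have hcomm' : ∀ s : D, σ s = s → s * (y + σ y) = (y + σ y) * s := fun s hs => hcomm s hs y
  generalize y + σ y = t at *
  have hneg : ∀ a : D, σ (-a) = -σ a := map_neg (AddMonoidHom.mk' σ hadd)
  have hx : (x + σ x) * t = t * (x + σ x) := hcomm' _ (by rw [hadd, hinvo, add_comm])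
  have hxσ : σ x * t - t * σ x = t * x - x * t := by
    rw [add_mul, mul_add] at hx
    rw [sub_eq_sub_iff_add_eq_add, add_comm, hx]
  obtain ⟨d, hd⟩ : ∃ d, d = t * x - x * t := ⟨_, rfl⟩
  have hσd : σ d = d := by
    rw [hd, sub_eq_add_neg, hadd, hneg, hmul, hmul, hσt, ← sub_eq_add_neg, hxσ, sub_eq_add_neg]
  have key : ∀ s : D, σ s = s → d * s * σ x = x * s * d := by
    intro s hs
    have h₁ := hcomm' (x * s * σ x) (by simp only [hmul, hinvo, hs, mul_assoc])
    have h₂ := hcomm' s hs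
    have h₃ : x * s * d = x * (s * (σ x * t)) - x * ((s * t) * σ x) := by
      rw [hd, ← hxσ]; noncomm_ring
    have h₄ : d * s * σ x = t * (x * s * σ x) - x * ((t * s) * σ x) := by
      rw [hd]; noncomm_ring
    rw [h₃, h₄, ← h₁, h₂]; noncomm_ring
  by_cases hd0 : d = 0
  · exact (sub_eq_zero.mp (hd.symm.trans hd0)).symm
  · have h1 : d * σ x = x * d := by
      have hone : σ 1 = 1 := by
        have := hmul (σ 1) 1
        rw [mul_one, hinvo, mul_one] at this
        exact this.symm
      simpa using key 1 hone
    have h2 := key d hσd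
    have h3 : d * x = x * d := by
      rw [mul_assoc, h1, ← mul_assoc] at h2
      exact mul_right_cancel₀ hd0 h2
    exact hcomm' x (mul_left_cancel₀ hd0 (h1.trans h3.symm))

/-- An involution of the first kind whose traces are central lives on a division ring of
dimension at most `4` over its center. -/
theorem finrank_center_le_four_of_trace_mem_center
    (hadd : ∀ x y : D, σ (x + y) = σ x + σ y)
    (hmul : ∀ x y : D, σ (x * y) = σ y * σ x)
    (hinvo : ∀ x : D, σ (σ x) = x)
    (hfirst : ∀ x ∈ Subring.center D, σ x = x)
    (htr : ∀ x : D, x + σ x ∈ Subring.center D) :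
    Module.Finite (Subring.center D) D ∧ Module.finrank (Subring.center D) D ≤ 4 := by
  have hone : σ 1 = 1 := hfirst 1 (Subring.one_mem _)
  have hpol : ∀ l a : D, l * σ a + a * σ l ∈ Subring.center D := fun l a => by
    simpa [hmul, hinvo] using htr (l * σ a)
  let B (a : D) : D →ₗ[Subring.center D] Subring.center D :=
    { toFun := fun l => ⟨l * σ a + a * σ l, hpol l a⟩
      map_add' := fun l m => by ext; simp only [hadd, Subring.coe_add]; noncomm_ring
      map_smul' := fun c l => by
        ext
        have hc := Subring.mem_center_iff.mp c.2
        change (c : D) * l * σ a + a * σ (c * l) = c * (l * σ a + a * σ l)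
        rw [hmul, hfirst _ c.2, hc (σ l), ← mul_assoc, hc a]
        noncomm_ring }
  suffices ∃ f : D →ₗ[Subring.center D] (Fin 4 → Subring.center D), Function.Injective f by
    obtain ⟨f, hf⟩ := this
    refine ⟨Module.Finite.of_injective f hf, ?_⟩
    simpa using LinearMap.finrank_le_finrank_of_injective hf
  by_cases hcomm : ∀ i j : D, i * j = j * i
  · refine ⟨LinearMap.pi fun _ =>
      { toFun := fun l => ⟨l, Subring.mem_center_iff.mpr fun g => hcomm g l⟩
        map_add' := fun _ _ => rfl
        map_smul' := fun _ _ => rfl }, fun x y hxy => ?_⟩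
    exact congrArg Subtype.val (congrFun hxy 0)
  · push Not at hcomm
    obtain ⟨i, j, hij⟩ := hcomm
    refine ⟨LinearMap.pi ![B 1, B i, B j, B (i * j)], ?_⟩
    rw [injective_iff_map_eq_zero]
    intro l hl
    have h0 : l * σ 1 + 1 * σ l = 0 := congrArg Subtype.val (congrFun hl 0)
    have h1 : l * σ i + i * σ l = 0 := congrArg Subtype.val (congrFun hl 1)
    have h2 : l * σ j + j * σ l = 0 := congrArg Subtype.val (congrFun hl 2)
    have h3 : l * σ (i * j) + i * j * σ l = 0 := congrArg Subtype.val (congrFun hl 3)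
    rw [hone, mul_one, one_mul] at h0
    have hσl : σ l = -l := (neg_eq_of_add_eq_zero_right h0).symm
    rw [hσl, mul_neg, add_neg_eq_zero] at h1 h2 h3
    by_contra hl0
    apply hij
    have h4 : l * σ (i * j) = l * σ (j * i) := by
      rw [h3, mul_assoc, ← h2, ← mul_assoc, ← h1, mul_assoc, ← hmul]
    rw [← hinvo (i * j), mul_left_cancel₀ hl0 h4, hinvo]

end InvolutionTraces

/-- Let `D` be a division ring with involution `σ` of the first kind,
and `K` a commutative subfield of `D` (not necessarily invariant under `σ`). If
`x + σ x ∈ K` and `x * σ x ∈ K` for every `x ∈ D`, then `D` is centrally finite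
with dimension at most `4` over its center: `D` is either a field or a quaternion
division ring. -/
theorem division_ring_left_algebraic_over_subfield (D : Type*) [DivisionRing D]
    (σ : D → D)
    (hadd : ∀ x y : D, σ (x + y) = σ x + σ y)
    (hmul : ∀ x y : D, σ (x * y) = σ y * σ x)
    (hinvo : ∀ x : D, σ (σ x) = x)
    (hfirst : ∀ x ∈ Subring.center D, σ x = x)
    (K : Subfield D) (hK : ∀ a ∈ K, ∀ b ∈ K, a * b = b * a)
    (h : ∀ x : D, x + σ x ∈ K ∧ x * σ x ∈ K) :
    Module.Finite (Subring.center D) D ∧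
      Module.finrank (Subring.center D) D ≤ 4 :=
  finrank_center_le_four_of_trace_mem_center hadd hmul hinvo hfirst
    (trace_mem_center_of_commute_symmetric hadd hmul hinvo fun _ hs y =>
      commute_trace_of_symmetric hadd hmul hinvo K hK h hs y)
end
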